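/- arXiv:2204.00412 — 2 statements merged into one kernel-verified Lean document; each statement's English description precedes it below -/
import Mathlib

section
/- Let h ∈ ℤ⁺. Let τ_1,…,τ_h ∈ (0,1) with τ_1 + ⋯ + τ_h = 1 and let a_1,…,a_h ∈ (0,∞) with a_1⋯a_h = 1. Then there exists a multiplicative complement (A_1,…,A_h) of order h such that for every 1 ≤ i ≤ h, lim_{x→∞} A_i(x) · (log x)^{1-τ_i} / x = a_i / Γ(τ_i). -/
open Filter Real

/-- Counting function: `A(x) = |A ∩ {1,…,⌊x⌋}|`. -/
noncomputable def cntF (A : Set ℕ) (x : ℝ) : ℕ := (A ∩ Set.Icc 1 ⌊x⌋₊).ncard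

/-- Common multiplicative representation function. -/
noncomputable def mulRepFam (h : ℕ) (A : Fin h → Set ℕ) (n : ℕ) : ℕ :=
  {f : Fin h → ℕ | (∀ i, f i ∈ A i) ∧ ∏ i, f i = n}.ncard

/-- `(A_1,…,A_h)` is a multiplicative complement of order `h`. -/
def IsMC (h : ℕ) (A : Fin h → Set ℕ) : Prop := ∀ n : ℕ, 1 ≤ n → 1 ≤ mulRepFam h A n

section WienerIkehara
open MeasureTheory Topology

/-- If the Laplace transform of a bounded function extends continuously to the closed right
half-plane, then its convolution with a kernel whose Fourier transform has compact support
tends to `0`. -/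
theorem tendsto_integral_mul_fourierKernel {B : ℝ → ℝ} {M : ℝ} (hBm : Measurable B)
    (hB : ∀ u, |B u| ≤ M) {G : ℂ → ℂ} (hG : ContinuousOn G {z | 0 ≤ z.re})
    (hBG : ∀ z : ℂ, 0 < z.re →
      ∫ u in Set.Ioi (0 : ℝ), (B u : ℂ) * Complex.exp (-z * u) = G z)
    {φ : ℝ → ℂ} (hφ : Continuous φ) (hφc : HasCompactSupport φ)
    (hK : Integrable fun v : ℝ => ∫ t : ℝ, φ t * Complex.exp (Complex.I * t * v)) :
    Tendsto (fun y : ℝ => ∫ u in Set.Ioi (0 : ℝ),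
      (B u : ℂ) * ∫ t : ℝ, φ t * Complex.exp (Complex.I * t * (y - u : ℝ))) atTop (𝓝 0) := by
  have hφi : Integrable φ := hφ.integrable_of_hasCompactSupport hφc
  set K : ℝ → ℂ := fun v : ℝ => ∫ t : ℝ, φ t * Complex.exp (Complex.I * t * v) with hKdef
  have hMnn : 0 ≤ M := (abs_nonneg _).trans (hB 0)
  -- the identity for positive `ε`
  have key : ∀ y ε : ℝ, 0 < ε →
      ∫ u in Set.Ioi (0 : ℝ), ((B u : ℂ) * Complex.exp (-(ε : ℂ) * u)) * K (y - u) =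
      ∫ t : ℝ, φ t * Complex.exp (Complex.I * t * y) * G (ε + Complex.I * t) := by
    intro y ε hε
    have hexp : IntegrableOn (fun u : ℝ => (B u : ℂ) * Complex.exp (-(ε : ℂ) * u))
        (Set.Ioi 0) := by
      have h1 : IntegrableOn (fun u : ℝ => M * Real.exp (-ε * u)) (Set.Ioi 0) :=
        (integrableOn_exp_mul_Ioi (by linarith) 0).const_mul M
      refine h1.mono' (by fun_prop) (Eventually.of_forall fun u => ?_)
      rw [norm_mul, Complex.norm_real, Complex.norm_exp]
      simp only [Complex.mul_re, Complex.neg_re, Complex.ofReal_re, Complex.neg_im,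
        Complex.ofReal_im, mul_zero, sub_zero, Real.norm_eq_abs]
      gcongr
      exact hB u
    have hprod := hexp.mul_prod hφi
    have hprod2 : Integrable (fun z : ℝ × ℝ =>
        ((B z.1 : ℂ) * Complex.exp (-(ε : ℂ) * z.1) * φ z.2) *
          Complex.exp (Complex.I * z.2 * (y - z.1 : ℝ)))
        ((volume.restrict (Set.Ioi (0 : ℝ))).prod volume) := by
      refine hprod.mul_bdd (c := 1) (by fun_prop) (Eventually.of_forall fun z => ?_)
      rw [Complex.norm_exp]
      simp
    have hsw := integral_integral_swap
      (f := fun u t : ℝ => ((B u : ℂ) * Complex.exp (-(ε : ℂ) * u) * φ t) *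
          Complex.exp (Complex.I * t * (y - u : ℝ))) hprod2
    calc _ = ∫ u in Set.Ioi (0 : ℝ), ∫ t : ℝ, ((B u : ℂ) * Complex.exp (-(ε : ℂ) * u) * φ t) *
          Complex.exp (Complex.I * t * (y - u : ℝ)) := by
          congr 1; ext u
          rw [hKdef]
          simp only
          rw [← integral_const_mul]
          congr 1; ext t; ring
      _ = _ := by
          rw [hsw]
          congr 1; ext t
          rw [← hBG (ε + Complex.I * t) (by simpa using hε), ← integral_const_mul]
          congr 1; ext u
          have : Complex.exp (-(ε + Complex.I * t) * u) =
            Complex.exp (-(ε : ℂ) * u) * Complex.exp (-Complex.I * t * u) := by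
            rw [← Complex.exp_add]; congr 1; ring
          have h2 : Complex.exp (Complex.I * t * (y - u : ℝ)) =
            Complex.exp (Complex.I * t * y) * Complex.exp (-Complex.I * t * u) := by
            rw [← Complex.exp_add]; congr 1; push_cast; ring
          rw [this, h2]; ring
  obtain ⟨R, hR⟩ := hφc.isCompact.isBounded.subset_closedBall 0
  have hφR : ∀ t, R < |t| → φ t = 0 := by
    intro t ht
    by_contra h
    have := hR (subset_tsupport _ h)
    simp at this
    linarith
  -- bound for `G`
  obtain ⟨C, hC⟩ : ∃ C, ∀ ε ∈ Set.Icc (0 : ℝ) 1, ∀ t ∈ Set.Icc (-R) R,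
      ‖G (ε + Complex.I * t)‖ ≤ C := by
    have hcomp : IsCompact (Set.Icc (0 : ℝ) 1 ×ˢ Set.Icc (-R) R) :=
      isCompact_Icc.prod isCompact_Icc
    have hcont : ContinuousOn (fun z : ℝ × ℝ => G (z.1 + Complex.I * z.2))
        (Set.Icc (0 : ℝ) 1 ×ˢ Set.Icc (-R) R) := by
      refine hG.comp (by fun_prop) ?_
      rintro ⟨a, b⟩ ⟨h1, -⟩
      simpa using h1.1
    obtain ⟨C, hC⟩ := hcomp.exists_bound_of_continuousOn hcont
    exact ⟨C, fun ε hε t ht => hC (ε, t) ⟨hε, ht⟩⟩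
  have hGline : ∀ ε : ℝ, 0 ≤ ε → Continuous fun t : ℝ => G (ε + Complex.I * t) := by
    intro ε hε
    refine hG.comp_continuous (by fun_prop) fun t => ?_
    simpa using hε
  have key0 : ∀ y : ℝ, ∫ u in Set.Ioi (0 : ℝ), (B u : ℂ) * K (y - u) =
      ∫ t : ℝ, φ t * Complex.exp (Complex.I * t * y) * G (Complex.I * t) := by
    intro y
    have hKy : Integrable fun u => K (y - u) := hK.comp_sub_left y
    have l1 : Tendsto (fun ε : ℝ => ∫ u in Set.Ioi (0 : ℝ),
        ((B u : ℂ) * Complex.exp (-(ε : ℂ) * u)) * K (y - u)) (𝓝[>] 0)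
        (𝓝 (∫ u in Set.Ioi (0 : ℝ), (B u : ℂ) * K (y - u))) := by
      refine tendsto_integral_filter_of_dominated_convergence (fun u => M * ‖K (y - u)‖) ?_ ?_ ?_ ?_
      · exact Eventually.of_forall fun ε =>
          (by fun_prop : Measurable fun u : ℝ => (B u : ℂ) * Complex.exp (-(ε : ℂ) * u)).aestronglyMeasurable.mul hKy.aestronglyMeasurable.restrict
      · filter_upwards [self_mem_nhdsWithin] with ε hε
        refine (ae_restrict_iff' measurableSet_Ioi).2 (Eventually.of_forall fun u hu => ?_)
        rw [norm_mul, norm_mul, Complex.norm_real, Complex.norm_exp]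
        gcongr
        have : Real.exp (-(ε : ℂ) * u).re ≤ 1 := by
          rw [Real.exp_le_one_iff]
          simp only [Complex.mul_re, Complex.neg_re, Complex.ofReal_re, Complex.neg_im,
            Complex.ofReal_im, mul_zero, sub_zero]
          have : 0 < ε * u := mul_pos hε hu
          linarith
        calc _ ≤ M * 1 := by
              gcongr
              exact hB u
          _ = M := mul_one M
      · exact (hKy.norm.const_mul M).restrict
      · refine Eventually.of_forall fun u => ?_
        have : Tendsto (fun ε : ℝ => ((B u : ℂ) * Complex.exp (-(ε : ℂ) * u)) * K (y - u)) (𝓝 0)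
            (𝓝 (((B u : ℂ) * Complex.exp (-((0 : ℝ) : ℂ) * u)) * K (y - u))) :=
          (by fun_prop : Continuous fun ε : ℝ =>
            ((B u : ℂ) * Complex.exp (-(ε : ℂ) * u)) * K (y - u)).tendsto 0
        simpa using this.mono_left nhdsWithin_le_nhds
    have l2 : Tendsto (fun ε : ℝ =>
        ∫ t : ℝ, φ t * Complex.exp (Complex.I * t * y) * G (ε + Complex.I * t)) (𝓝[>] 0)
        (𝓝 (∫ t : ℝ, φ t * Complex.exp (Complex.I * t * y) * G (Complex.I * t))) := by
      refine tendsto_integral_filter_of_dominated_convergence (fun t => C * ‖φ t‖) ?_ ?_ ?_ ?_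
      · filter_upwards [self_mem_nhdsWithin] with ε hε
        have := hGline ε (le_of_lt hε)
        exact ((by fun_prop : Continuous fun t : ℝ =>
          φ t * Complex.exp (Complex.I * t * y)).mul this).aestronglyMeasurable
      · filter_upwards [Ioo_mem_nhdsGT (zero_lt_one' ℝ)] with ε hε
        refine Eventually.of_forall fun t => ?_
        rcases lt_or_ge R |t| with h | h
        · simp [hφR t h]
        · rw [norm_mul, norm_mul, Complex.norm_exp]
          have := hC ε ⟨hε.1.le, hε.2.le⟩ t (abs_le.1 h)
          simp only [Complex.mul_re, Complex.I_re, Complex.ofReal_re, Complex.mul_im,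
            Complex.ofReal_im, Complex.I_im]
          simp only [zero_mul, mul_zero, sub_zero, Real.exp_zero, mul_one]
          rw [mul_comm]
          gcongr
      · exact hφi.norm.const_mul C
      · refine Eventually.of_forall fun t => ?_
        have h1 : Tendsto (fun ε : ℝ => G (ε + Complex.I * t)) (𝓝[>] 0)
            (𝓝 (G (Complex.I * t))) := by
          have := (hG (Complex.I * t) (by simp)).tendsto
          refine this.comp (tendsto_nhdsWithin_iff.2 ⟨?_, ?_⟩)
          · have : Tendsto (fun ε : ℝ => (ε : ℂ) + Complex.I * t) (𝓝 0)
              (𝓝 (((0 : ℝ) : ℂ) + Complex.I * t)) :=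
              (by fun_prop : Continuous fun ε : ℝ => (ε : ℂ) + Complex.I * t).tendsto 0
            simpa using this.mono_left nhdsWithin_le_nhds
          · filter_upwards [self_mem_nhdsWithin] with ε hε
            simpa using le_of_lt hε
        exact tendsto_const_nhds.mul h1
    refine tendsto_nhds_unique l1 (l2.congr' ?_)
    filter_upwards [self_mem_nhdsWithin] with ε hε
    exact (key y ε hε).symm
  have rl := Real.tendsto_integral_exp_smul_cocompact (fun t : ℝ => φ t * G (Complex.I * t))
  have hw : Tendsto (fun y : ℝ => -y / (2 * π)) atTop (cocompact ℝ) := by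
    have : Tendsto (fun y : ℝ => -y / (2 * π)) atTop atBot :=
      (tendsto_neg_atTop_atBot).atBot_div_const (by positivity)
    exact this.mono_right atBot_le_cocompact
  refine (rl.comp hw).congr fun y => ?_
  rw [key0]
  simp only [Function.comp]
  congr 1; ext t
  rw [Circle.smul_def, Real.fourierChar_apply, smul_eq_mul]
  have : ((2 * π * -(t * (-y / (2 * π))) : ℝ) : ℂ) * Complex.I = Complex.I * t * y := by
    have : (2 * π * -(t * (-y / (2 * π))) : ℝ) = t * y := by field_simp
    rw [this]; push_cast; ring
  rw [this]; ring

end WienerIkehara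

section FejerKernel
open MeasureTheory Topology

/-- The triangle function, whose Fourier transform is the Fejér kernel. -/
noncomputable def triangleFun (t : ℝ) : ℝ := max 0 (1 - |t|)

/-- The Fejér kernel. -/
noncomputable def fejerKernel (v : ℝ) : ℝ := if v = 0 then 1 else 2 * (1 - cos v) / v ^ 2

theorem continuous_triangleFun : Continuous triangleFun := by
  unfold triangleFun; fun_prop

theorem triangleFun_eq_zero {t : ℝ} (ht : 1 ≤ |t|) : triangleFun t = 0 := by
  simp [triangleFun, ht]

theorem hasCompactSupport_triangleFun : HasCompactSupport triangleFun := by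
  refine HasCompactSupport.intro (isCompact_Icc (a := (-1 : ℝ)) (b := 1)) fun t ht => ?_
  refine triangleFun_eq_zero ?_
  by_contra! h
  exact ht (abs_le.1 h.le)

theorem integral_triangleFun_mul_exp (v : ℝ) :
    ∫ t : ℝ, (triangleFun t : ℂ) * Complex.exp (Complex.I * t * v) = fejerKernel v := by
  have hcont : Continuous fun t : ℝ => (triangleFun t : ℂ) * Complex.exp (Complex.I * t * v) := by
    have := continuous_triangleFun
    fun_prop
  rw [← intervalIntegral.integral_eq_integral_of_support_subset (a := -1) (b := 1),
    ← intervalIntegral.integral_add_adjacent_intervals (b := 0)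
      (hcont.intervalIntegrable _ _) (hcont.intervalIntegrable _ _)]
  swap
  · intro t ht
    by_contra h
    refine ht ?_
    have : 1 ≤ |t| := by
      by_contra! h1
      exact h ⟨(abs_lt.1 h1).1, (abs_lt.1 h1).2.le⟩
    simp [triangleFun_eq_zero this]
  have e1 : ∫ t in (-1 : ℝ)..0, (triangleFun t : ℂ) * Complex.exp (Complex.I * t * v) =
      ∫ t in (-1 : ℝ)..0, (1 + t : ℂ) * Complex.exp (Complex.I * v * t) := by
    refine intervalIntegral.integral_congr fun t ht => ?_
    rw [Set.uIcc_of_le (by norm_num)] at ht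
    have : triangleFun t = 1 + t := by
      rw [triangleFun, abs_of_nonpos ht.2, max_eq_right (by linarith [ht.1])]; ring
    simp only [this]
    push_cast
    ring_nf
  have e2 : ∫ t in (0 : ℝ)..1, (triangleFun t : ℂ) * Complex.exp (Complex.I * t * v) =
      ∫ t in (0 : ℝ)..1, (1 - t : ℂ) * Complex.exp (Complex.I * v * t) := by
    refine intervalIntegral.integral_congr fun t ht => ?_
    rw [Set.uIcc_of_le (by norm_num)] at ht
    have : triangleFun t = 1 - t := by
      rw [triangleFun, abs_of_nonneg ht.1, max_eq_right (by linarith [ht.2])]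
    simp only [this]
    push_cast
    ring_nf
  rw [e1, e2]
  by_cases hv : v = 0
  · subst hv
    have d1 : ∀ t : ℝ, HasDerivAt (fun t : ℝ => (t + t ^ 2 / 2 : ℂ)) (1 + t) t := by
      intro t
      have h := ((hasDerivAt_id (t : ℂ)).add (((hasDerivAt_id (t : ℂ)).pow 2).div_const 2)).comp_ofReal
      convert! h using 1
      simp
    have d2 : ∀ t : ℝ, HasDerivAt (fun t : ℝ => (t - t ^ 2 / 2 : ℂ)) (1 - t) t := by
      intro t
      have h := ((hasDerivAt_id (t : ℂ)).sub (((hasDerivAt_id (t : ℂ)).pow 2).div_const 2)).comp_ofReal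
      convert! h using 1
      simp
    simp only [Complex.ofReal_zero, mul_zero, zero_mul, Complex.exp_zero, mul_one]
    rw [intervalIntegral.integral_eq_sub_of_hasDerivAt (fun t _ => d1 t)
        ((by fun_prop : Continuous fun t : ℝ => (1 + t : ℂ)).intervalIntegrable _ _),
      intervalIntegral.integral_eq_sub_of_hasDerivAt (fun t _ => d2 t)
        ((by fun_prop : Continuous fun t : ℝ => (1 - t : ℂ)).intervalIntegrable _ _)]
    simp [fejerKernel]
    norm_num
  · have hvc : (v : ℂ) ≠ 0 := by exact_mod_cast hv
    set c : ℂ := Complex.I * v with hc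
    have hc0 : c ≠ 0 := mul_ne_zero Complex.I_ne_zero hvc
    have d0 : ∀ t : ℝ, HasDerivAt (fun t : ℝ => Complex.exp (c * t)) (Complex.exp (c * t) * c) t := by
      intro t
      have := (((hasDerivAt_id (t : ℂ)).const_mul c).cexp).comp_ofReal
      simpa using this
    have d1 : ∀ t : ℝ, HasDerivAt
        (fun t : ℝ => (((1 : ℂ) + t) / c - 1 / c ^ 2) * Complex.exp (c * t))
        ((1 + t) * Complex.exp (c * t)) t := by
      intro t
      have h := ((((hasDerivAt_id (t : ℂ)).const_add 1).div_const c).sub_const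
        (1 / c ^ 2)).comp_ofReal
      have h2 := h.mul (d0 t)
      convert! h2 using 1
      simp only [id]
      field_simp
      ring
    have d2 : ∀ t : ℝ, HasDerivAt
        (fun t : ℝ => (((1 : ℂ) - t) / c + 1 / c ^ 2) * Complex.exp (c * t))
        ((1 - t) * Complex.exp (c * t)) t := by
      intro t
      have h := ((((hasDerivAt_id (t : ℂ)).const_sub 1).div_const c).add_const
        (1 / c ^ 2)).comp_ofReal
      have h2 := h.mul (d0 t)
      convert! h2 using 1
      simp only [id]
      field_simp
      ring
    rw [intervalIntegral.integral_eq_sub_of_hasDerivAt (fun t _ => d1 t)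
        ((by fun_prop : Continuous fun t : ℝ =>
          (1 + t : ℂ) * Complex.exp (c * t)).intervalIntegrable _ _),
      intervalIntegral.integral_eq_sub_of_hasDerivAt (fun t _ => d2 t)
        ((by fun_prop : Continuous fun t : ℝ =>
          (1 - t : ℂ) * Complex.exp (c * t)).intervalIntegrable _ _)]
    rw [fejerKernel, if_neg hv]
    have hcos : Complex.exp (c * (1 : ℝ)) + Complex.exp (c * (-1 : ℝ)) = 2 * Complex.cos v := by
      rw [Complex.two_cos, hc]
      push_cast
      ring_nf
    have hc2 : c ^ 2 = -(v : ℂ) ^ 2 := by rw [hc, mul_pow, Complex.I_sq]; ring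
    push_cast at hcos ⊢
    have : (2 * (1 - Complex.cos v) / (v : ℂ) ^ 2) = (2 * Complex.cos v - 2) / c ^ 2 := by
      rw [hc2]; field_simp; ring
    rw [this, ← hcos]
    simp only [mul_zero, Complex.exp_zero]
    field_simp
    ring

theorem fejerKernel_nonneg (v : ℝ) : 0 ≤ fejerKernel v := by
  unfold fejerKernel
  split_ifs
  · exact zero_le_one
  · have := cos_le_one v
    exact div_nonneg (by linarith) (sq_nonneg v)

theorem measurable_fejerKernel : Measurable fejerKernel := by
  unfold fejerKernel
  exact Measurable.ite (measurableSet_singleton 0) (by fun_prop) (by fun_prop)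

theorem integrable_fejerKernel : Integrable fejerKernel := by
  refine (integrable_inv_one_add_sq.const_mul 8).mono' measurable_fejerKernel.aestronglyMeasurable
    (Eventually.of_forall fun v => ?_)
  rw [Real.norm_of_nonneg (fejerKernel_nonneg v), ← div_eq_mul_inv,
    le_div_iff₀ (by positivity)]
  unfold fejerKernel
  split_ifs with h
  · subst h; norm_num
  · have hv : 0 < v ^ 2 := by positivity
    rw [div_mul_eq_mul_div, div_le_iff₀ hv]
    have h1 := Real.one_sub_sq_div_two_le_cos (x := v)
    have h2 := neg_one_le_cos v
    nlinarith

theorem integral_fejerKernel_pos : 0 < ∫ v, fejerKernel v := by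
  rw [integral_pos_iff_support_of_nonneg fejerKernel_nonneg integrable_fejerKernel]
  refine lt_of_lt_of_le ?_ (measure_mono (s := Set.Ioo 0 π) fun v hv => ?_)
  · simp [Real.volume_Ioo, pi_pos]
  · have hc : cos v < 1 := by
      have := cos_lt_cos_of_nonneg_of_le_pi le_rfl hv.2.le hv.1
      simpa using this
    have hv0 : v ≠ 0 := hv.1.ne'
    rw [Function.mem_support, fejerKernel, if_neg hv0]
    have : 0 < 2 * (1 - cos v) / v ^ 2 := by
      apply div_pos
      · linarith
      · positivity
    exact this.ne'

end FejerKernel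

section WienerIkehara
open MeasureTheory Topology

theorem integrable_scaled_fejerKernel {L : ℝ} (hL : 0 < L) (y : ℝ) :
    Integrable fun u => L * fejerKernel (L * (y - u)) :=
  ((integrable_fejerKernel.comp_mul_left' hL.ne').const_mul L).comp_sub_left y

theorem integral_scaled_fejerKernel {L : ℝ} (hL : 0 < L) (y : ℝ) :
    ∫ u, L * fejerKernel (L * (y - u)) = ∫ v, fejerKernel v := by
  rw [integral_sub_left_eq_self (fun v => L * fejerKernel (L * v)) volume y, integral_const_mul,
    Measure.integral_comp_mul_left, abs_of_pos (inv_pos.2 hL), smul_eq_mul,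
    mul_inv_cancel_left₀ hL.ne']

theorem exists_scaled_fejerKernel_concentrated {δ ε : ℝ} (hδ : 0 < δ) (hε : 0 < ε) :
    ∃ L : ℝ, 0 < L ∧ ∀ y : ℝ, (1 - ε) * ∫ v, fejerKernel v ≤
      ∫ u in Set.Icc (y - δ) (y + δ), L * fejerKernel (L * (y - u)) := by
  set I := ∫ v, fejerKernel v with hI
  have hIpos : 0 < I := integral_fejerKernel_pos
  have hcov : AECover (volume : Measure ℝ) atTop fun L : ℝ => Set.Icc (-(L * δ)) (L * δ) :=
    aecover_Icc (tendsto_neg_atTop_atBot.comp (tendsto_id.atTop_mul_const hδ))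
      (tendsto_id.atTop_mul_const hδ)
  have ht := hcov.integral_tendsto_of_countably_generated integrable_fejerKernel
  have hlt : (1 - ε) * I < I := by nlinarith
  obtain ⟨L, hL1, hL⟩ := ((ht.eventually (eventually_gt_nhds hlt)).and (eventually_gt_atTop 0)).exists
  refine ⟨L, hL, fun y => hL1.le.trans (le_of_eq ?_)⟩
  rw [← integral_indicator measurableSet_Icc, ← integral_indicator measurableSet_Icc]
  have e1 : (fun u => (Set.Icc (y - δ) (y + δ)).indicator
      (fun u => L * fejerKernel (L * (y - u))) u) =
      fun u => (fun v => L * (Set.Icc (-(L * δ)) (L * δ)).indicator fejerKernel (L * v)) (y - u) := by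
    ext u
    simp only [Set.indicator_apply]
    have : u ∈ Set.Icc (y - δ) (y + δ) ↔ L * (y - u) ∈ Set.Icc (-(L * δ)) (L * δ) := by
      rw [Set.mem_Icc, Set.mem_Icc, ← mul_neg, mul_le_mul_iff_right₀ hL, mul_le_mul_iff_right₀ hL]
      constructor <;> rintro ⟨h1, h2⟩ <;> constructor <;> linarith
    simp only [this]
    split_ifs <;> simp
  rw [e1, integral_sub_left_eq_self
      (fun v => L * (Set.Icc (-(L * δ)) (L * δ)).indicator fejerKernel (L * v)) volume y,
    integral_const_mul, Measure.integral_comp_mul_left, abs_of_pos (inv_pos.2 hL), smul_eq_mul,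
    mul_inv_cancel_left₀ hL.ne']

theorem tendsto_integral_mul_scaled_fejerKernel {B : ℝ → ℝ} {M : ℝ} (hBm : Measurable B)
    (hB : ∀ u, |B u| ≤ M) {G : ℂ → ℂ} (hG : ContinuousOn G {z | 0 ≤ z.re})
    (hBG : ∀ z : ℂ, 0 < z.re →
      ∫ u in Set.Ioi (0 : ℝ), (B u : ℂ) * Complex.exp (-z * u) = G z) {L : ℝ} (hL : 0 < L) :
    Tendsto (fun y : ℝ => ∫ u in Set.Ioi (0 : ℝ), B u * (L * fejerKernel (L * (y - u))))
      atTop (𝓝 0) := by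
  set φ : ℝ → ℂ := fun t => (triangleFun (L⁻¹ * t) : ℂ) with hφ
  have hφc : Continuous φ := by
    have := continuous_triangleFun
    fun_prop
  have hφs : HasCompactSupport φ := by
    have h1 : HasCompactSupport fun t : ℝ => triangleFun (L⁻¹ * t) :=
      hasCompactSupport_triangleFun.comp_homeomorph (Homeomorph.mulLeft₀ L⁻¹ (inv_ne_zero hL.ne'))
    exact h1.comp_left (g := fun x : ℝ => (x : ℂ)) Complex.ofReal_zero
  have hK : ∀ v : ℝ, ∫ t : ℝ, φ t * Complex.exp (Complex.I * t * v) =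
      ((L * fejerKernel (L * v) : ℝ) : ℂ) := by
    intro v
    have := Measure.integral_comp_mul_left (fun s : ℝ =>
      (triangleFun s : ℂ) * Complex.exp (Complex.I * s * (L * v : ℝ))) L⁻¹
    rw [integral_triangleFun_mul_exp, inv_inv, abs_of_pos hL] at this
    rw [Complex.ofReal_mul, ← smul_eq_mul, Complex.coe_smul, ← this]
    congr 1; ext t
    have hLc : (L : ℂ) ≠ 0 := by exact_mod_cast hL.ne'
    simp only [hφ]
    congr 2
    push_cast
    field_simp
  have hKi : Integrable fun v : ℝ => ∫ t : ℝ, φ t * Complex.exp (Complex.I * t * v) := by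
    simp_rw [hK]
    exact ((integrable_fejerKernel.comp_mul_left' hL.ne').const_mul L).ofReal
  have := tendsto_integral_mul_fourierKernel hBm hB hG hBG hφc hφs hKi
  simp_rw [hK] at this
  rw [← tendsto_ofReal_iff, Complex.ofReal_zero]
  refine (this.congr fun y => ?_)
  rw [← integral_complex_ofReal]
  congr 1; ext u
  push_cast
  ring

/-- A Wiener–Ikehara type theorem for bounded functions `H` such that `exp u * H u` is monotone. -/
theorem tendsto_one_of_laplace {H : ℝ → ℝ} {M : ℝ} (hHm : Measurable H) (hH0 : ∀ u, 0 ≤ H u)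
    (hHM : ∀ u, H u ≤ M) (hslow : ∀ u v, u ≤ v → H u * exp (-(v - u)) ≤ H v)
    {G : ℂ → ℂ} (hG : ContinuousOn G {z | 0 ≤ z.re})
    (hBG : ∀ z : ℂ, 0 < z.re →
      ∫ u in Set.Ioi (0 : ℝ), ((H u - 1 : ℝ) : ℂ) * Complex.exp (-z * u) = G z) :
    Tendsto H atTop (𝓝 1) := by
  have hM0 : 0 ≤ M := (hH0 0).trans (hHM 0)
  set I := ∫ v, fejerKernel v with hI
  have hIpos : 0 < I := integral_fejerKernel_pos
  -- the two basic one-sided estimates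
  have main : ∀ x : ℝ, 0 < x → x < 1 → ∀ᶠ y in atTop,
      (1 - x) * H (y - x) ≤ exp (2 * x) * (1 + x) ∧
      exp (-(2 * x)) * (1 - (2 + M) * x) ≤ H (y + x) := by
    intro x hx hx1
    obtain ⟨L, hL, hconc⟩ := exists_scaled_fejerKernel_concentrated hx hx
    have hE := tendsto_integral_mul_scaled_fejerKernel (B := fun u => H u - 1) (M := M + 1)
      (by fun_prop) (fun u => by
        rw [abs_le]; constructor <;> linarith [hH0 u, hHM u]) hG hBG hL
    have hxI : 0 < x * I := mul_pos hx hIpos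
    filter_upwards [hE.eventually (eventually_lt_nhds hxI),
      hE.eventually (eventually_gt_nhds (show -(x * I) < 0 by linarith)),
      eventually_gt_atTop x] with y hy1 hy2 hyx
    set k : ℝ → ℝ := fun u => L * fejerKernel (L * (y - u)) with hk
    have hk0 : ∀ u, 0 ≤ k u := fun u => mul_nonneg hL.le (fejerKernel_nonneg _)
    have hki : Integrable k := integrable_scaled_fejerKernel hL y
    have hHki : Integrable fun u => H u * k u := by
      refine hki.bdd_mul (c := M) hHm.aestronglyMeasurable (Eventually.of_forall fun u => ?_)
      rw [Real.norm_of_nonneg (hH0 u)]; exact hHM u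
    have hkI : ∫ u, k u = I := integral_scaled_fejerKernel hL y
    have hsub : Set.Icc (y - x) (y + x) ⊆ Set.Ioi 0 := fun u hu => by
      have := hu.1; simp only [Set.mem_Ioi]; linarith
    have hkc : (1 - x) * I ≤ ∫ u in Set.Icc (y - x) (y + x), k u := hconc y
    have hsplit : ∫ u in Set.Ioi (0 : ℝ), (H u - 1) * k u =
        (∫ u in Set.Ioi (0 : ℝ), H u * k u) - ∫ u in Set.Ioi (0 : ℝ), k u := by
      rw [← integral_sub hHki.integrableOn hki.integrableOn]
      congr 1; ext u; ring
    rw [hsplit] at hy1 hy2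
    have hkle : ∫ u in Set.Ioi (0 : ℝ), k u ≤ I := by
      rw [← hkI]
      exact setIntegral_le_integral hki (Eventually.of_forall hk0)
    have hkge : ∫ u in Set.Icc (y - x) (y + x), k u ≤ ∫ u in Set.Ioi (0 : ℝ), k u :=
      setIntegral_mono_set hki.integrableOn (Eventually.of_forall hk0) hsub.eventuallyLE
    constructor
    · have h1 : ∫ u in Set.Icc (y - x) (y + x), H u * k u ≤ ∫ u in Set.Ioi (0 : ℝ), H u * k u :=
        setIntegral_mono_set hHki.integrableOn
          (Eventually.of_forall fun u => mul_nonneg (hH0 u) (hk0 u)) hsub.eventuallyLE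
      have h2 : ∫ u in Set.Icc (y - x) (y + x), (H (y - x) * exp (-(2 * x))) * k u ≤
          ∫ u in Set.Icc (y - x) (y + x), H u * k u := by
        refine setIntegral_mono_on (hki.const_mul _).integrableOn hHki.integrableOn
          measurableSet_Icc fun u hu => ?_
        refine mul_le_mul_of_nonneg_right ?_ (hk0 u)
        refine le_trans ?_ (hslow (y - x) u hu.1)
        refine mul_le_mul_of_nonneg_left (exp_le_exp.2 ?_) (hH0 _)
        linarith [hu.2]
      rw [integral_const_mul] at h2
      have h3 : H (y - x) * exp (-(2 * x)) * ((1 - x) * I) ≤ (1 + x) * I := by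
        calc _ ≤ H (y - x) * exp (-(2 * x)) * ∫ u in Set.Icc (y - x) (y + x), k u :=
              mul_le_mul_of_nonneg_left hkc (mul_nonneg (hH0 _) (exp_pos _).le)
          _ ≤ _ := by linarith
      have h4 : H (y - x) * exp (-(2 * x)) * (1 - x) ≤ 1 + x := by
        refine le_of_mul_le_mul_right ?_ hIpos
        linarith
      rw [exp_neg] at h4
      have he := exp_pos (2 * x)
      calc (1 - x) * H (y - x)
          = exp (2 * x) * (H (y - x) * (exp (2 * x))⁻¹ * (1 - x)) := by field_simp
        _ ≤ _ := mul_le_mul_of_nonneg_left h4 he.le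
    · have hset : ∫ u in Set.Ioi (0 : ℝ), H u * k u ≤
          ∫ u in Set.Ioi (0 : ℝ), ((Set.Icc (y - x) (y + x)).indicator
            (fun u => (H (y + x) * exp (2 * x)) * k u) u +
            (M * k u - (Set.Icc (y - x) (y + x)).indicator (fun u => M * k u) u)) := by
        refine integral_mono hHki.integrableOn ?_ fun u => ?_
        · exact (((hki.const_mul _).indicator measurableSet_Icc).add
            ((hki.const_mul _).sub ((hki.const_mul _).indicator measurableSet_Icc))).integrableOn
        · by_cases hu : u ∈ Set.Icc (y - x) (y + x)
          · simp only [Set.indicator_of_mem hu, sub_self, add_zero]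
            refine mul_le_mul_of_nonneg_right ?_ (hk0 u)
            have h1 := hslow u (y + x) hu.2
            have h2 : exp (-(y + x - u)) * exp (2 * x) ≥ 1 := by
              rw [← exp_add]
              refine one_le_exp ?_
              linarith [hu.1]
            have h3 := mul_le_mul_of_nonneg_right h1 (exp_pos (2 * x)).le
            nlinarith [hH0 u]
          · simp only [Set.indicator_of_notMem hu, sub_zero, zero_add]
            exact mul_le_mul_of_nonneg_right (hHM u) (hk0 u)
      have i1 : IntegrableOn (fun u => (Set.Icc (y - x) (y + x)).indicator
          (fun u => (H (y + x) * exp (2 * x)) * k u) u) (Set.Ioi 0) :=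
        ((hki.const_mul _).indicator measurableSet_Icc).integrableOn
      have i2 : IntegrableOn (fun u => M * k u) (Set.Ioi 0) := (hki.const_mul _).integrableOn
      have i3 : IntegrableOn (fun u => (Set.Icc (y - x) (y + x)).indicator
          (fun u => M * k u) u) (Set.Ioi 0) :=
        ((hki.const_mul _).indicator measurableSet_Icc).integrableOn
      have i23 : IntegrableOn (fun u => M * k u - (Set.Icc (y - x) (y + x)).indicator
          (fun u => M * k u) u) (Set.Ioi 0) := i2.sub i3
      rw [integral_add i1 i23, integral_sub i2 i3,
        setIntegral_indicator measurableSet_Icc, setIntegral_indicator measurableSet_Icc,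
        Set.inter_eq_self_of_subset_right hsub, integral_const_mul (H (y + x) * exp (2 * x)) k,
        integral_const_mul M k, integral_const_mul M k] at hset
      set J := ∫ u in Set.Icc (y - x) (y + x), k u with hJ
      set T := ∫ u in Set.Ioi (0 : ℝ), k u with hT
      have hJI : J ≤ I := hkge.trans hkle
      have h5 : H (y + x) * exp (2 * x) * J ≤ H (y + x) * exp (2 * x) * I :=
        mul_le_mul_of_nonneg_left hJI (mul_nonneg (hH0 _) (exp_pos _).le)
      have h6 : M * (T - J) ≤ M * (x * I) := mul_le_mul_of_nonneg_left (by linarith) hM0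
      have h7 : (1 - (2 + M) * x) * I ≤ H (y + x) * exp (2 * x) * I := by nlinarith
      have h8 := le_of_mul_le_mul_right h7 hIpos
      calc exp (-(2 * x)) * (1 - (2 + M) * x) ≤ exp (-(2 * x)) * (H (y + x) * exp (2 * x)) :=
            mul_le_mul_of_nonneg_left h8 (exp_pos _).le
        _ = H (y + x) := by rw [exp_neg]; field_simp
  rw [tendsto_order]
  constructor
  · intro c hc
    have hcont : Tendsto (fun x : ℝ => exp (-(2 * x)) * (1 - (2 + M) * x)) (𝓝[>] 0) (𝓝 1) := by
      have : Tendsto (fun x : ℝ => exp (-(2 * x)) * (1 - (2 + M) * x)) (𝓝 0)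
          (𝓝 (exp (-(2 * 0)) * (1 - (2 + M) * 0))) :=
        (by fun_prop : Continuous fun x : ℝ => exp (-(2 * x)) * (1 - (2 + M) * x)).tendsto 0
      simp only [mul_zero, neg_zero, exp_zero, sub_zero, mul_one] at this
      exact this.mono_left nhdsWithin_le_nhds
    obtain ⟨x, hxc, hx⟩ := ((hcont.eventually (eventually_gt_nhds hc)).and
      (Ioo_mem_nhdsGT (zero_lt_one' ℝ))).exists
    have := (tendsto_atTop_add_const_right atTop (-x) tendsto_id).eventually (main x hx.1 hx.2)
    filter_upwards [this] with y hy
    have h := hy.2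
    simp only [id, neg_add_cancel_right] at h
    linarith
  · intro b hb
    have hcont : Tendsto (fun x : ℝ => exp (2 * x) * (1 + x) - (1 - x) * b) (𝓝[>] 0)
        (𝓝 (1 - b)) := by
      have : Tendsto (fun x : ℝ => exp (2 * x) * (1 + x) - (1 - x) * b) (𝓝 0)
          (𝓝 (exp (2 * 0) * (1 + 0) - (1 - 0) * b)) :=
        (by fun_prop : Continuous fun x : ℝ => exp (2 * x) * (1 + x) - (1 - x) * b).tendsto 0
      simp only [mul_zero, exp_zero, sub_zero, add_zero, mul_one, one_mul] at this
      exact this.mono_left nhdsWithin_le_nhds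
    obtain ⟨x, hxc, hx⟩ := ((hcont.eventually (eventually_lt_nhds (sub_neg.2 hb))).and
      (Ioo_mem_nhdsGT (zero_lt_one' ℝ))).exists
    have := (tendsto_atTop_add_const_right atTop x tendsto_id).eventually (main x hx.1 hx.2)
    filter_upwards [this] with y hy
    have h := hy.1
    simp only [id, add_sub_cancel_right] at h
    refine lt_of_mul_lt_mul_left (a := 1 - x) ?_ (by linarith [hx.2])
    linarith

end WienerIkehara

section PrimeNumberTheorem
open MeasureTheory Topology ArithmeticFunction

theorem exists_continuousOn_LSeries_vonMangoldt_sub :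
    ∃ g : ℂ → ℂ, ContinuousOn g {s | 1 ≤ s.re} ∧
      ∀ s : ℂ, 1 < s.re → LSeries (fun n => (Λ n : ℂ)) s - 1 / (s - 1) = g s := by
  refine ⟨vonMangoldt.LFunctionResidueClassAux (q := 1) 1,
    vonMangoldt.continuousOn_LFunctionResidueClassAux 1, fun s hs => ?_⟩
  rw [vonMangoldt.eqOn_LFunctionResidueClassAux (q := 1) (a := 1) isUnit_one hs]
  have : (fun n : ℕ => ((vonMangoldt.residueClass (q := 1) 1 n : ℝ) : ℂ)) =
      fun n => (Λ n : ℂ) := by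
    ext n
    simp [vonMangoldt.residueClass, Subsingleton.elim (n : ZMod 1) 1]
  simp [this]

theorem psi_isBigO_nat :
    (fun n : ℕ => ∑ k ∈ Finset.Icc 1 n, Λ k) =O[atTop] fun n : ℕ => (n : ℝ) ^ (1 : ℝ) := by
  refine Asymptotics.IsBigO.of_bound (Real.log 4 + 4) (Eventually.of_forall fun n => ?_)
  have h := Chebyshev.psi_le_const_mul_self (x := (n : ℝ)) n.cast_nonneg
  have h0 := Chebyshev.psi_nonneg (n : ℝ)
  rw [Chebyshev.psi, Nat.floor_natCast] at h h0
  rw [rpow_one, Real.norm_of_nonneg (n.cast_nonneg), show Finset.Icc 1 n = Finset.Ioc 0 n from rfl,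
    Real.norm_of_nonneg h0]
  exact h

theorem integral_psi_exp_laplace {s : ℂ} (hs : 1 < s.re) :
    s * ∫ u in Set.Ioi (0 : ℝ), ((Chebyshev.psi (exp u) * exp (-u) : ℝ) : ℂ) *
      Complex.exp (-(s - 1) * u) = LSeries (fun n => (Λ n : ℂ)) s := by
  rw [LSeries_eq_mul_integral_of_nonneg (fun n => Λ n) zero_le_one hs psi_isBigO_nat
    fun n => vonMangoldt_nonneg]
  have h0 : Set.Ioi (1 : ℝ) = exp '' Set.Ioi 0 := by rw [Real.image_exp_Ioi, exp_zero]
  rw [h0, integral_image_eq_integral_abs_deriv_smul measurableSet_Ioi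
    (fun x _ => (Real.hasDerivAt_exp x).hasDerivWithinAt) (Real.exp_injective.injOn)]
  congr 2; ext u
  have hcp : ((exp u : ℝ) : ℂ) ^ (-(s + 1)) = Complex.exp (-(s + 1) * u) := by
    rw [Complex.cpow_def_of_ne_zero (by exact_mod_cast (exp_pos u).ne'), ← Complex.ofReal_log
      (exp_pos u).le, log_exp, mul_comm]
  rw [hcp, abs_of_pos (exp_pos u), Chebyshev.psi,
    show Finset.Ioc 0 ⌊exp u⌋₊ = Finset.Icc 1 ⌊exp u⌋₊ from rfl, Complex.real_smul]
  push_cast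
  have : Complex.exp (u : ℂ) * Complex.exp (-(s + 1) * u) =
      Complex.exp (-(u : ℂ)) * Complex.exp (-(s - 1) * u) := by
    rw [← Complex.exp_add, ← Complex.exp_add]; congr 1; ring
  linear_combination -(∑ k ∈ Finset.Icc 1 ⌊exp u⌋₊, (Λ k : ℂ)) * this

theorem tendsto_psi_exp : Tendsto (fun u => Chebyshev.psi (exp u) * exp (-u)) atTop (𝓝 1) := by
  obtain ⟨g, hg, hgs⟩ := exists_continuousOn_LSeries_vonMangoldt_sub
  have hmeas : Measurable fun u => Chebyshev.psi (exp u) * exp (-u) :=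
    (Chebyshev.psi_mono.measurable.comp measurable_exp).mul (by fun_prop)
  have hnn : ∀ u, 0 ≤ Chebyshev.psi (exp u) * exp (-u) := fun u =>
    mul_nonneg (Chebyshev.psi_nonneg _) (exp_pos _).le
  have hbd : ∀ u, Chebyshev.psi (exp u) * exp (-u) ≤ Real.log 4 + 4 := fun u => by
    have := Chebyshev.psi_le_const_mul_self (exp_pos u).le
    rw [exp_neg, ← div_eq_mul_inv, div_le_iff₀ (exp_pos u)]
    exact this
  refine tendsto_one_of_laplace (M := Real.log 4 + 4) hmeas hnn hbd ?_
    (G := fun z => (g (z + 1) - 1) / (z + 1)) ?_ ?_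
  · intro u v huv
    rw [mul_assoc, ← exp_add, show -u + -(v - u) = -v by ring]
    exact mul_le_mul_of_nonneg_right (Chebyshev.psi_mono (exp_le_exp.2 huv)) (exp_pos _).le
  · refine ContinuousOn.div ((hg.comp (by fun_prop) ?_).sub continuousOn_const) (by fun_prop) ?_
    · intro z hz
      simpa using hz
    · intro z hz h
      have := congrArg Complex.re h
      simp only [Set.mem_ofPred_eq] at hz
      simp at this
      linarith
  · intro z hz
    have hz1 : 1 < (z + 1).re := by simpa using hz
    have hz0 : z + 1 ≠ 0 := fun h => by rw [h] at hz1; norm_num at hz1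
    have hzz : z ≠ 0 := fun h => by rw [h] at hz; norm_num at hz
    have h1 := integral_psi_exp_laplace hz1
    have h2 := hgs _ hz1
    rw [add_sub_cancel_right] at h1 h2
    have h3 : ∫ u in Set.Ioi (0 : ℝ), Complex.exp (-z * u) = 1 / z := by
      rw [integral_exp_mul_complex_Ioi (by simpa using hz)]
      simp
    have hexp : IntegrableOn (fun u : ℝ => Complex.exp (-z * u)) (Set.Ioi 0) :=
      integrableOn_exp_mul_complex_Ioi (by simpa using hz) 0
    have hψint : IntegrableOn (fun u : ℝ => ((Chebyshev.psi (exp u) * exp (-u) : ℝ) : ℂ) *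
        Complex.exp (-z * u)) (Set.Ioi 0) := by
      refine hexp.bdd_mul (c := Real.log 4 + 4)
        (Complex.measurable_ofReal.comp hmeas).aestronglyMeasurable (Eventually.of_forall fun u => ?_)
      rw [Complex.norm_real, Real.norm_of_nonneg (hnn u)]
      exact hbd u
    have hsub : ∫ u in Set.Ioi (0 : ℝ), ((Chebyshev.psi (exp u) * exp (-u) - 1 : ℝ) : ℂ) *
        Complex.exp (-z * u) = (∫ u in Set.Ioi (0 : ℝ),
          ((Chebyshev.psi (exp u) * exp (-u) : ℝ) : ℂ) * Complex.exp (-z * u)) - 1 / z := by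
      rw [← h3, ← integral_sub hψint hexp]
      congr 1; ext u; push_cast; ring
    rw [hsub, ← h2, ← h1]
    field_simp
    ring

/-- The prime number theorem, in the form `ψ(x) ~ x`. -/
theorem tendsto_psi_div : Tendsto (fun x : ℝ => Chebyshev.psi x / x) atTop (𝓝 1) := by
  refine (tendsto_psi_exp.comp tendsto_log_atTop).congr' ?_
  filter_upwards [eventually_gt_atTop 0] with x hx
  simp only [Function.comp, exp_log hx, exp_neg]
  rfl

/-- The prime number theorem, in the form `θ(x) ~ x`. -/
theorem tendsto_theta_div : Tendsto (fun x : ℝ => Chebyshev.theta x / x) atTop (𝓝 1) := by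
  have h1 : Tendsto (fun x : ℝ => (Chebyshev.psi x - Chebyshev.theta x) / x) atTop (𝓝 0) := by
    refine (Chebyshev.isBigO_psi_sub_theta_sqrt.trans_isLittleO ?_).tendsto_div_nhds_zero
    refine (Asymptotics.isLittleO_iff_tendsto' ?_).2 ?_
    · filter_upwards [eventually_gt_atTop 0] with x hx h
      exact absurd h hx.ne'
    · have := tendsto_inv_atTop_zero.comp tendsto_sqrt_atTop
      refine this.congr' ?_
      filter_upwards [eventually_gt_atTop 0] with x hx
      simp only [Function.comp]
      rw [Real.sqrt_div_self', one_div]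
  have := tendsto_psi_div.sub h1
  rw [sub_zero] at this
  refine this.congr fun x => ?_
  ring

end PrimeNumberTheorem

section GreedyBalancing
open Topology

variable {ι : Type*} [Fintype ι]

theorem exists_forall_le_and_nonneg [Nonempty ι] (r : ι → ℝ) (hr : ∑ i, r i = 0) :
    ∃ i, (∀ j, r j ≤ r i) ∧ 0 ≤ r i := by
  obtain ⟨i, hi⟩ := Finite.exists_max r
  refine ⟨i, hi, not_lt.1 fun hlt => ?_⟩
  have := Finset.sum_lt_sum_of_nonempty (s := Finset.univ) (f := r) (g := fun _ => 0)
    Finset.univ_nonempty fun j _ => (hi j).trans_lt hlt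
  simp [hr] at this

/-- An index at which `r` is largest. -/
noncomputable def argmaxIndex [Nonempty ι] (r : ι → ℝ) : ι :=
  (Finite.exists_max r).choose

theorem le_argmaxIndex [Nonempty ι] (r : ι → ℝ) (j : ι) : r j ≤ r (argmaxIndex r) :=
  (Finite.exists_max r).choose_spec j

theorem argmaxIndex_nonneg [Nonempty ι] (r : ι → ℝ) (hr : ∑ i, r i = 0) :
    0 ≤ r (argmaxIndex r) := by
  obtain ⟨i, -, hi⟩ := exists_forall_le_and_nonneg r hr
  exact hi.trans (le_argmaxIndex r i)

open Classical in
/-- The deficit vector of the greedy allocation: at every step the weight `w n` is given to the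
index with the largest deficit, while the deficit of `i` grows by `w n * τ i`. -/
noncomputable def greedyDeficit [Nonempty ι] (w : ℕ → ℝ) (τ α : ι → ℝ) : ℕ → ι → ℝ
  | 0 => α
  | n + 1 => fun i => greedyDeficit w τ α n i -
      w n * ((if argmaxIndex (greedyDeficit w τ α n) = i then 1 else 0) - τ i)

variable [Nonempty ι] {w : ℕ → ℝ} {τ α : ι → ℝ}

theorem sum_greedyDeficit (hτ : ∑ i, τ i = 1) (hα : ∑ i, α i = 0) (n : ℕ) :
    ∑ i, greedyDeficit w τ α n i = 0 := by
  classical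
  induction n with
  | zero => exact hα
  | succ n ih =>
    simp only [greedyDeficit]
    rw [Finset.sum_sub_distrib, ih, ← Finset.mul_sum, Finset.sum_sub_distrib, hτ]
    simp

theorem eventually_neg_le_greedyDeficit (hw : ∀ n, 0 < w n)
    (hratio : Tendsto (fun n => w n / w (n + 1)) atTop (𝓝 1))
    (hdiv : Tendsto (fun n => ∑ k ∈ Finset.range n, w k) atTop atTop)
    (hτ0 : ∀ i, 0 < τ i) (hτ1 : ∀ i, τ i < 1) (hτ : ∑ i, τ i = 1) (hα : ∑ i, α i = 0) (i : ι) :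
    ∀ᶠ n in atTop, -w n ≤ greedyDeficit w τ α n i := by
  have h1 : ∀ᶠ n in atTop, w n / w (n + 1) < 1 + τ i :=
    hratio.eventually_lt_const (by linarith [hτ0 i])
  obtain ⟨N, hN⟩ := eventually_atTop.1 h1
  have hstep : ∀ n ≥ N, -w n ≤ greedyDeficit w τ α n i →
      -w (n + 1) ≤ greedyDeficit w τ α (n + 1) i := by
    intro n hn hr
    have hlt := (div_lt_iff₀ (hw (n + 1))).1 (hN n hn)
    have hb : (1 - τ i) * w n ≤ w (n + 1) := by
      have := mul_le_mul_of_nonneg_left hlt.le (sub_pos.2 (hτ1 i)).le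
      nlinarith [hw (n + 1), sq_nonneg (τ i)]
    simp only [greedyDeficit]
    split_ifs with hc
    · have := argmaxIndex_nonneg (greedyDeficit w τ α n) (sum_greedyDeficit hτ hα n)
      rw [hc] at this
      linarith
    · linarith
  have hex : ∃ n ≥ N, -w n ≤ greedyDeficit w τ α n i := by
    by_contra! hcon
    have hform : ∀ m, greedyDeficit w τ α (N + m) i = greedyDeficit w τ α N i +
        τ i * (∑ k ∈ Finset.range (N + m), w k - ∑ k ∈ Finset.range N, w k) := by
      intro m
      induction m with
      | zero => simp
      | succ m ih =>
        have hneg : greedyDeficit w τ α (N + m) i < 0 :=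
          (hcon (N + m) (by omega)).trans (neg_neg_of_pos (hw _))
        have hc : argmaxIndex (greedyDeficit w τ α (N + m)) ≠ i := fun hc => by
          have := argmaxIndex_nonneg (greedyDeficit w τ α (N + m)) (sum_greedyDeficit hτ hα _)
          rw [hc] at this
          linarith
        rw [← add_assoc, Finset.sum_range_succ]
        simp only [greedyDeficit, if_neg hc]
        rw [ih]; ring
    have hlarge := (tendsto_atTop.1 hdiv (∑ k ∈ Finset.range N, w k -
      greedyDeficit w τ α N i / τ i)).and (eventually_ge_atTop N)
    obtain ⟨n, hn, hnN⟩ := hlarge.exists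
    obtain ⟨m, rfl⟩ := Nat.exists_eq_add_of_le hnN
    have h2 := hcon (N + m) hnN
    have h3 : 0 ≤ greedyDeficit w τ α N i +
        τ i * (∑ k ∈ Finset.range (N + m), w k - ∑ k ∈ Finset.range N, w k) := by
      have := mul_le_mul_of_nonneg_left hn (hτ0 i).le
      rw [mul_sub, mul_div_cancel₀ _ (hτ0 i).ne'] at this
      linarith
    rw [hform] at h2
    linarith [hw (N + m)]
  obtain ⟨n, hn, hr⟩ := hex
  refine eventually_atTop.2 ⟨n, fun m hm => ?_⟩
  induction m, hm using Nat.le_induction with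
  | base => exact hr
  | succ m hm ih => exact hstep m (hn.trans hm) ih

theorem exists_abs_greedyDeficit_le (hw : ∀ n, 0 < w n)
    (hratio : Tendsto (fun n => w n / w (n + 1)) atTop (𝓝 1))
    (hdiv : Tendsto (fun n => ∑ k ∈ Finset.range n, w k) atTop atTop)
    (hτ0 : ∀ i, 0 < τ i) (hτ1 : ∀ i, τ i < 1) (hτ : ∑ i, τ i = 1) (hα : ∑ i, α i = 0) (i : ι) :
    ∃ C, ∀ n, |greedyDeficit w τ α n i| ≤ C * w n := by
  classical
  have hO : (fun n => greedyDeficit w τ α n i) =O[atTop] w := by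
    refine Asymptotics.IsBigO.of_bound (Fintype.card ι) ?_
    filter_upwards [eventually_all.2 fun j =>
      eventually_neg_le_greedyDeficit hw hratio hdiv hτ0 hτ1 hτ hα j] with n hn
    rw [Real.norm_of_nonneg (hw n).le, Real.norm_eq_abs, abs_le]
    have hcard : (1 : ℝ) ≤ Fintype.card ι := by exact_mod_cast Fintype.card_pos
    constructor
    · nlinarith [hn i, hw n]
    · have h1 := sum_greedyDeficit (w := w) hτ hα n
      rw [← Finset.add_sum_erase _ _ (Finset.mem_univ i)] at h1
      have h2 : ∑ j ∈ Finset.univ.erase i, -w n ≤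
          ∑ j ∈ Finset.univ.erase i, greedyDeficit w τ α n j := Finset.sum_le_sum fun j _ => hn j
      rw [Finset.sum_const, Finset.card_erase_of_mem (Finset.mem_univ i), nsmul_eq_mul,
        Finset.card_univ, Nat.cast_sub Fintype.card_pos] at h2
      push_cast at h2
      nlinarith [hw n]
  obtain ⟨C, -, hC⟩ := Asymptotics.bound_of_isBigO_nat_atTop hO
  refine ⟨C, fun n => ?_⟩
  have := hC (hw n).ne'
  rwa [Real.norm_of_nonneg (hw n).le] at this

/-- If the partial sums of `w * c` converge with error `O(w n)`, with `w` slowly varying,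
then `c` averages to zero against slowly growing monotone weights `L`. -/
theorem isLittleO_sum_mul_of_deficit {r c L : ℕ → ℝ} {C : ℝ} (hw : ∀ n, 0 < w n)
    (hratio : Tendsto (fun n => w n / w (n + 1)) atTop (𝓝 1))
    (hr : ∀ n, |r n| ≤ C * w n) (hc : ∀ n, r (n + 1) = r n - w n * c n)
    (hL0 : ∀ n, 0 ≤ L n) (hL : Monotone L)
    (hS : Tendsto (fun n => ∑ k ∈ Finset.range n, L k) atTop atTop)
    (hLS : L =o[atTop] fun n => ∑ k ∈ Finset.range n, L k) :
    (fun n => ∑ k ∈ Finset.range n, c k * L k) =o[atTop] fun n => ∑ k ∈ Finset.range n, L k := by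
  have hC : 0 ≤ C := nonneg_of_mul_nonneg_left ((abs_nonneg _).trans (hr 0)) (hw 0)
  set q : ℕ → ℝ := fun n => r n / w n with hq
  have hqC : ∀ n, |q n| ≤ C := fun n => by
    rw [hq, abs_div, abs_of_pos (hw n), div_le_iff₀ (hw n)]
    exact hr n
  have hcq : ∀ n, c n = q n - q (n + 1) + q (n + 1) * (1 - w (n + 1) / w n) := fun n => by
    have h1 := (hw n).ne'
    have h2 := (hw (n + 1)).ne'
    simp only [hq, hc n]
    field_simp
    ring
  have hmain : (fun n => ∑ k ∈ Finset.range n, q (k + 1) * (1 - w (k + 1) / w k) * L k)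
      =o[atTop] fun n => ∑ k ∈ Finset.range n, L k := by
    refine Asymptotics.IsLittleO.sum_range (Asymptotics.IsLittleO.of_bound fun ε hε => ?_) hL0 hS
    have hinv : Tendsto (fun n => C * |1 - w (n + 1) / w n|) atTop (𝓝 0) := by
      have := hratio.inv₀ one_ne_zero
      simp only [inv_div, inv_one] at this
      simpa using ((this.const_sub 1).abs).const_mul C
    filter_upwards [hinv.eventually_le_const hε] with n hn
    rw [norm_mul, norm_mul]
    refine mul_le_mul_of_nonneg_right (le_trans ?_ hn) (norm_nonneg _)
    exact mul_le_mul_of_nonneg_right (hqC _) (norm_nonneg _)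
  have htel : (fun n => ∑ k ∈ Finset.range n, (q k - q (k + 1)) * L k)
      =o[atTop] fun n => ∑ k ∈ Finset.range n, L k := by
    refine Asymptotics.IsBigO.trans_isLittleO
      (Asymptotics.IsBigO.of_bound (2 * C) (Eventually.of_forall fun n => ?_)) hLS
    have hform : ∑ k ∈ Finset.range n, (q k - q (k + 1)) * L k = q 0 * L 0 - q n * L n +
        ∑ k ∈ Finset.range n, q (k + 1) * (L (k + 1) - L k) := by
      induction n with
      | zero => simp
      | succ n ih => rw [Finset.sum_range_succ, Finset.sum_range_succ, ih]; ring
    have hb : |∑ k ∈ Finset.range n, q (k + 1) * (L (k + 1) - L k)| ≤ C * (L n - L 0) := by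
      rw [← Finset.sum_range_sub, Finset.mul_sum]
      refine (Finset.abs_sum_le_sum_abs _ _).trans (Finset.sum_le_sum fun k _ => ?_)
      have hk := sub_nonneg.2 (hL k.le_succ)
      rw [abs_mul, abs_of_nonneg hk]
      exact mul_le_mul_of_nonneg_right (hqC _) hk
    have h0 : |q 0 * L 0| ≤ C * L 0 := by
      rw [abs_mul, abs_of_nonneg (hL0 0)]
      exact mul_le_mul_of_nonneg_right (hqC _) (hL0 0)
    have hn : |q n * L n| ≤ C * L n := by
      rw [abs_mul, abs_of_nonneg (hL0 n)]
      exact mul_le_mul_of_nonneg_right (hqC _) (hL0 n)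
    rw [hform, Real.norm_eq_abs, Real.norm_of_nonneg (hL0 n)]
    rw [abs_le] at *
    constructor <;> linarith [hb.1, hb.2, h0.1, h0.2, hn.1, hn.2]
  refine (htel.add hmain).congr_left fun n => ?_
  rw [← Finset.sum_add_distrib]
  refine Finset.sum_congr rfl fun k _ => ?_
  rw [hcq k]; ring

end GreedyBalancing

section PrimeColoring
open Topology

theorem sum_range_ite_prime (g : ℕ → ℝ) (N : ℕ) :
    ∑ m ∈ Finset.range N, (if m.Prime then g m else 0) =
      ∑ k ∈ Finset.range (Nat.count Nat.Prime N), g (Nat.nth Nat.Prime k) := by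
  induction N with
  | zero => simp
  | succ N ih =>
    rw [Finset.sum_range_succ, ih, Nat.count_succ]
    split_ifs with hN
    · rw [Finset.sum_range_succ, Nat.nth_count hN]
    · simp

theorem count_prime_nth (n : ℕ) : Nat.count Nat.Prime (Nat.nth Nat.Prime n) = n :=
  Nat.count_nth_of_infinite Nat.infinite_setOfPred_prime n

theorem tendsto_count_prime : Tendsto (Nat.count Nat.Prime) atTop atTop :=
  tendsto_atTop_atTop_of_monotone (Nat.count_monotone _) fun n =>
    ⟨Nat.nth Nat.Prime n, (count_prime_nth n).ge⟩

theorem tendsto_nth_prime : Tendsto (Nat.nth Nat.Prime) atTop atTop :=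
  (Nat.nth_strictMono Nat.infinite_setOfPred_prime).tendsto_atTop

theorem tendsto_nth_prime_real :
    Tendsto (fun n => (Nat.nth Nat.Prime n : ℝ)) atTop atTop :=
  tendsto_natCast_atTop_atTop.comp tendsto_nth_prime

theorem theta_eq_sum_range (x : ℝ) : Chebyshev.theta x =
    ∑ m ∈ Finset.range (⌊x⌋₊ + 1), if m.Prime then Real.log m else 0 := by
  rw [Chebyshev.theta, Finset.sum_filter, Finset.sum_range_succ']
  simp only [Nat.not_prime_zero, if_false, add_zero]
  rw [Finset.range_eq_Ico, Finset.sum_Ico_add' (fun m : ℕ => if m.Prime then Real.log m else 0) 0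
    ⌊x⌋₊ 1]
  rfl

theorem theta_nth_prime (n : ℕ) : Chebyshev.theta (Nat.nth Nat.Prime n) =
    ∑ k ∈ Finset.range (n + 1), Real.log (Nat.nth Nat.Prime k) := by
  rw [theta_eq_sum_range, Nat.floor_natCast, sum_range_ite_prime fun m => Real.log m,
    Nat.count_succ, if_pos (Nat.prime_nth_prime n), count_prime_nth]

theorem tendsto_log_nth_prime_div :
    Tendsto (fun n => Real.log (Nat.nth Nat.Prime n) / Nat.nth Nat.Prime n) atTop (𝓝 0) :=
  (Real.isLittleO_log_id_atTop.tendsto_div_nhds_zero).comp tendsto_nth_prime_real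

theorem nth_prime_pos (n : ℕ) : (0 : ℝ) < Nat.nth Nat.Prime n := by
  exact_mod_cast (Nat.prime_nth_prime n).pos

theorem tendsto_nth_prime_ratio :
    Tendsto (fun n => (Nat.nth Nat.Prime n : ℝ) / Nat.nth Nat.Prime (n + 1)) atTop (𝓝 1) := by
  have h1 := tendsto_theta_div.comp tendsto_nth_prime_real
  have h2 := (h1.comp (tendsto_add_atTop_nat 1)).sub
    (tendsto_log_nth_prime_div.comp (tendsto_add_atTop_nat 1))
  have h3 := h2.div h1 one_ne_zero
  rw [sub_zero, div_one] at h3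
  refine h3.congr' ?_
  filter_upwards [h1.eventually_const_lt zero_lt_one] with n hn
  have hp := nth_prime_pos n
  have hp1 := nth_prime_pos (n + 1)
  have hθ : Chebyshev.theta (Nat.nth Nat.Prime n) ≠ 0 := fun h => by
    simp only [Function.comp, h, zero_div, lt_irrefl] at hn
  have := theta_nth_prime (n + 1)
  rw [Finset.sum_range_succ, ← theta_nth_prime n] at this
  simp only [Pi.div_apply, Function.comp]
  rw [this]
  field_simp
  ring

/-- The weight `-log (1 - 1 / m)`. -/
noncomputable def eulerWeight (m : ℕ) : ℝ := -Real.log (1 - 1 / m)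

theorem one_div_le_eulerWeight {m : ℕ} (hm : 2 ≤ m) : 1 / (m : ℝ) ≤ eulerWeight m := by
  have h2 : (2 : ℝ) ≤ m := by exact_mod_cast hm
  have h : 0 < 1 - 1 / (m : ℝ) := by
    rw [sub_pos, div_lt_one (by linarith)]; linarith
  have := Real.log_le_sub_one_of_pos h
  rw [eulerWeight]; linarith

theorem eulerWeight_nth_pos (n : ℕ) : 0 < eulerWeight (Nat.nth Nat.Prime n) :=
  lt_of_lt_of_le (one_div_pos.2 (nth_prime_pos n))
    (one_div_le_eulerWeight (Nat.prime_nth_prime n).two_le)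

theorem tendsto_mul_eulerWeight :
    Tendsto (fun n => (Nat.nth Nat.Prime n : ℝ) * eulerWeight (Nat.nth Nat.Prime n))
      atTop (𝓝 1) := by
  have := ((Real.tendsto_mul_log_one_add_div_atTop (-1)).comp tendsto_nth_prime_real).neg
  rw [neg_neg] at this
  refine this.congr fun n => ?_
  simp only [Function.comp, eulerWeight]
  rw [mul_neg, neg_div, sub_eq_add_neg]

theorem tendsto_eulerWeight_nth :
    Tendsto (fun n => eulerWeight (Nat.nth Nat.Prime n)) atTop (𝓝 0) := by
  have := tendsto_mul_eulerWeight.div_atTop tendsto_nth_prime_real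
  refine this.congr fun n => ?_
  have := (nth_prime_pos n).ne'
  field_simp

theorem tendsto_eulerWeight_ratio :
    Tendsto (fun n => eulerWeight (Nat.nth Nat.Prime n) / eulerWeight (Nat.nth Nat.Prime (n + 1)))
      atTop (𝓝 1) := by
  have h := (tendsto_mul_eulerWeight.div (tendsto_mul_eulerWeight.comp (tendsto_add_atTop_nat 1))
    one_ne_zero).div tendsto_nth_prime_ratio one_ne_zero
  simp only [div_one] at h
  refine h.congr fun n => ?_
  have h1 := (nth_prime_pos n).ne'
  have h2 := (nth_prime_pos (n + 1)).ne'
  have h3 := (eulerWeight_nth_pos (n + 1)).ne'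
  simp only [Pi.div_apply, Function.comp]
  field_simp

theorem tendsto_sum_one_div_nth_prime :
    Tendsto (fun n => ∑ k ∈ Finset.range n, 1 / (Nat.nth Nat.Prime k : ℝ)) atTop atTop := by
  have h := not_summable_one_div_on_primes
  rw [not_summable_iff_tendsto_nat_atTop_of_nonneg fun n =>
    Set.indicator_nonneg (fun m _ => by positivity) n] at h
  refine (h.comp tendsto_nth_prime).congr fun n => ?_
  have := sum_range_ite_prime (fun m => 1 / (m : ℝ)) (Nat.nth Nat.Prime n)
  rw [count_prime_nth] at this
  rw [← this]
  simp [Set.indicator_apply]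

theorem tendsto_sum_eulerWeight :
    Tendsto (fun n => ∑ k ∈ Finset.range n, eulerWeight (Nat.nth Nat.Prime k)) atTop atTop :=
  tendsto_atTop_mono (fun _ => Finset.sum_le_sum fun k _ =>
    one_div_le_eulerWeight (Nat.prime_nth_prime k).two_le) tendsto_sum_one_div_nth_prime

/-- The primes can be coloured so that the colour classes have prescribed relative densities and
the associated Mertens-type series have prescribed sums. -/
theorem exists_prime_coloring {ι : Type*} [Fintype ι] [DecidableEq ι] [Nonempty ι] (τ α : ι → ℝ)
    (hτ0 : ∀ i, 0 < τ i) (hτ1 : ∀ i, τ i < 1) (hτ : ∑ i, τ i = 1) (hα : ∑ i, α i = 0) :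
    ∃ col : ℕ → ι, ∀ i,
      Tendsto (fun N : ℕ => ∑ m ∈ Finset.range N,
        if m.Prime then ((if col m = i then 1 else 0) - τ i) * eulerWeight m else 0)
          atTop (𝓝 (α i)) ∧
      Tendsto (fun x : ℝ => (∑ m ∈ Finset.range (⌊x⌋₊ + 1),
        if m.Prime then (if col m = i then Real.log m else 0) else 0) / x) atTop (𝓝 (τ i)) := by
  set p := Nat.nth Nat.Prime with hp
  set w : ℕ → ℝ := fun n => eulerWeight (p n) with hw
  set c : ℕ → ι := fun n => argmaxIndex (greedyDeficit w τ α n) with hc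
  refine ⟨fun m => c (Nat.count Nat.Prime m), fun i => ?_⟩
  obtain ⟨C, hC⟩ := exists_abs_greedyDeficit_le (w := w) eulerWeight_nth_pos
    tendsto_eulerWeight_ratio tendsto_sum_eulerWeight hτ0 hτ1 hτ hα i
  have hstep : ∀ n, greedyDeficit w τ α (n + 1) i = greedyDeficit w τ α n i -
      w n * ((if c n = i then 1 else 0) - τ i) := fun n => by
    simp only [greedyDeficit, hc]
    congr
  have hsum : ∀ n, ∑ k ∈ Finset.range n, ((if c k = i then 1 else 0) - τ i) * w k =
      α i - greedyDeficit w τ α n i := by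
    intro n
    induction n with
    | zero => simp [greedyDeficit]
    | succ n ih => rw [Finset.sum_range_succ, ih, hstep]; ring
  have hconv : ∀ (g : ι → ℝ → ℝ) (N : ℕ), (∑ m ∈ Finset.range N,
      if m.Prime then g (c (Nat.count Nat.Prime m)) m else 0) =
      ∑ k ∈ Finset.range (Nat.count Nat.Prime N), g (c k) (p k) := by
    intro g N
    rw [sum_range_ite_prime fun m => g (c (Nat.count Nat.Prime m)) m]
    refine Finset.sum_congr rfl fun k _ => ?_
    rw [count_prime_nth]
  constructor
  · have h0 : Tendsto (fun n => greedyDeficit w τ α n i) atTop (𝓝 0) := by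
      refine squeeze_zero_norm hC ?_
      simpa using tendsto_eulerWeight_nth.const_mul C
    have h1 := (h0.const_sub (α i)).comp tendsto_count_prime
    rw [sub_zero] at h1
    refine h1.congr fun N => ?_
    rw [Function.comp, ← hsum]
    exact (hconv (fun j x => ((if j = i then 1 else 0) - τ i) * -Real.log (1 - 1 / x)) N).symm
  · set L : ℕ → ℝ := fun n => Real.log (p n) with hL
    have hL0 : ∀ n, 0 ≤ L n := fun n => Real.log_natCast_nonneg _
    have hLm : Monotone L := fun m n hmn => Real.log_le_log (nth_prime_pos m)
      (by exact_mod_cast Nat.nth_monotone Nat.infinite_setOfPred_prime hmn)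
    have hSp : Tendsto (fun n => (∑ k ∈ Finset.range n, L k) / p n) atTop (𝓝 1) := by
      have := (tendsto_theta_div.comp tendsto_nth_prime_real).sub tendsto_log_nth_prime_div
      rw [sub_zero] at this
      refine this.congr fun n => ?_
      simp only [Function.comp]
      rw [theta_nth_prime, Finset.sum_range_succ]
      simp only [hL, hp]; ring
    have hS : Tendsto (fun n => ∑ k ∈ Finset.range n, L k) atTop atTop := by
      refine (hSp.pos_mul_atTop one_pos tendsto_nth_prime_real).congr fun n => ?_
      exact div_mul_cancel₀ _ (nth_prime_pos n).ne'
    have hLS : L =o[atTop] fun n => ∑ k ∈ Finset.range n, L k := by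
      refine (Asymptotics.isLittleO_iff_tendsto' ?_).2 ?_
      · filter_upwards [hS.eventually_gt_atTop 0] with n hn h
        exact absurd h hn.ne'
      · have := tendsto_log_nth_prime_div.div hSp one_ne_zero
        rw [zero_div] at this
        refine this.congr fun n => ?_
        exact div_div_div_cancel_right₀ (nth_prime_pos n).ne' _ _
    have hmain := isLittleO_sum_mul_of_deficit (w := w)
      (r := fun n => greedyDeficit w τ α n i) eulerWeight_nth_pos tendsto_eulerWeight_ratio hC
      hstep hL0 hLm hS hLS
    have hfl : Tendsto (fun x : ℝ => Nat.count Nat.Prime (⌊x⌋₊ + 1)) atTop atTop :=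
      tendsto_count_prime.comp ((tendsto_add_atTop_nat 1).comp tendsto_nat_floor_atTop)
    have hθ : ∀ x : ℝ, ∑ k ∈ Finset.range (Nat.count Nat.Prime (⌊x⌋₊ + 1)), L k =
        Chebyshev.theta x := fun x => by
      rw [theta_eq_sum_range, sum_range_ite_prime fun m => Real.log m]
    have h1 := (hmain.tendsto_div_nhds_zero.comp hfl).mul tendsto_theta_div
    have h2 := h1.add (tendsto_theta_div.const_mul (τ i))
    rw [zero_mul, zero_add, mul_one] at h2
    refine h2.congr' ?_
    filter_upwards [(hS.comp hfl).eventually_gt_atTop 0] with x hx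
    simp only [Function.comp] at hx ⊢
    rw [hθ] at hx ⊢
    rw [hconv (fun j y => if j = i then Real.log y else 0), div_mul_div_cancel₀ hx.ne', mul_div,
      ← add_div, ← hθ, Finset.mul_sum, ← Finset.sum_add_distrib]
    congr 1
    refine Finset.sum_congr rfl fun k _ => ?_
    simp only [hL]
    split_ifs <;> ring

end PrimeColoring

section AbelSummation
open Topology

theorem abs_sum_mul_sub_le {b v : ℕ → ℝ} {β ε K : ℝ} {M N : ℕ} (hε : 0 ≤ ε) (hMN : M ≤ N)
    (hv0 : v 0 = 1) (hv : Antitone v) (hvN : 0 ≤ v N)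
    (hK : ∀ n, |∑ k ∈ Finset.range n, b k - β| ≤ K)
    (hM : ∀ n ≥ M, |∑ k ∈ Finset.range n, b k - β| ≤ ε) :
    |∑ k ∈ Finset.range N, b k * v k - β| ≤ ε + K * (1 - v M) := by
  set B : ℕ → ℝ := fun n => ∑ k ∈ Finset.range n, b k with hB
  have hform : ∀ n, ∑ k ∈ Finset.range n, b k * v k - β = (B n - β) * v n +
      ∑ k ∈ Finset.range n, (B (k + 1) - β) * (v k - v (k + 1)) := by
    intro n
    induction n with
    | zero => simp [hB, hv0]
    | succ n ih =>
      rw [Finset.sum_range_succ, Finset.sum_range_succ, add_sub_right_comm, ih]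
      simp only [hB, Finset.sum_range_succ]
      ring
  have hbase : |∑ k ∈ Finset.range M, (B (k + 1) - β) * (v k - v (k + 1))| ≤ K * (1 - v M) := by
    rw [← hv0, ← Finset.sum_range_sub', Finset.mul_sum]
    refine (Finset.abs_sum_le_sum_abs _ _).trans (Finset.sum_le_sum fun k _ => ?_)
    have hk := sub_nonneg.2 (hv k.le_succ)
    rw [abs_mul, abs_of_nonneg hk]
    exact mul_le_mul_of_nonneg_right (hK _) hk
  have hind : ∀ n ≥ M, |∑ k ∈ Finset.range n, (B (k + 1) - β) * (v k - v (k + 1))| ≤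
      K * (1 - v M) + ε * (v M - v n) := by
    intro n hn
    induction n, hn using Nat.le_induction with
    | base => simpa using hbase
    | succ n hn ih =>
      rw [Finset.sum_range_succ]
      have hk := sub_nonneg.2 (hv n.le_succ)
      have h1 : |(B (n + 1) - β) * (v n - v (n + 1))| ≤ ε * (v n - v (n + 1)) := by
        rw [abs_mul, abs_of_nonneg hk]
        exact mul_le_mul_of_nonneg_right (hM _ (by omega)) hk
      refine (abs_add_le _ _).trans ((add_le_add ih h1).trans (le_of_eq ?_))
      ring
  rw [hform]
  have h1 : |(B N - β) * v N| ≤ ε * v N := by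
    rw [abs_mul, abs_of_nonneg hvN]
    exact mul_le_mul_of_nonneg_right (hM N hMN) hvN
  have hvM : v M ≤ 1 := hv0 ▸ hv M.zero_le
  refine (abs_add_le _ _).trans ((add_le_add h1 (hind N hMN)).trans ?_)
  nlinarith

/-- Abel's theorem for Dirichlet series at the origin. -/
theorem tendsto_tsum_mul_rpow_of_tendsto_sum {b : ℕ → ℝ} {β : ℝ}
    (hb : Tendsto (fun n => ∑ k ∈ Finset.range n, b k) atTop (𝓝 β))
    (hs : ∀ δ : ℝ, 0 < δ → Summable fun k : ℕ => b k * ((k : ℝ) + 1) ^ (-δ)) :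
    Tendsto (fun δ : ℝ => ∑' k : ℕ, b k * ((k : ℝ) + 1) ^ (-δ)) (𝓝[>] 0) (𝓝 β) := by
  obtain ⟨K, hK⟩ : ∃ K, ∀ n, |∑ k ∈ Finset.range n, b k - β| ≤ K := by
    obtain ⟨K, hK⟩ := (hb.sub_const β).abs.bddAbove_range
    exact ⟨K, fun n => hK ⟨n, rfl⟩⟩
  rw [Metric.tendsto_nhds]
  intro ε hε
  obtain ⟨M, hM⟩ := Metric.tendsto_atTop.1 hb (ε / 2) (half_pos hε)
  have hlim : Tendsto (fun δ : ℝ => ε / 2 + K * (1 - ((M : ℝ) + 1) ^ (-δ))) (𝓝[>] 0)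
      (𝓝 (ε / 2)) := by
    have hc : Continuous fun δ : ℝ => ε / 2 + K * (1 - ((M : ℝ) + 1) ^ (-δ)) := by
      have : Continuous fun δ : ℝ => ((M : ℝ) + 1) ^ (-δ) :=
        (Real.continuous_const_rpow (by positivity)).comp continuous_neg
      fun_prop
    simpa using (hc.tendsto 0).mono_left nhdsWithin_le_nhds
  filter_upwards [hlim.eventually_lt_const (half_lt_self hε), self_mem_nhdsWithin] with δ hδ hδ0
  have hδ0 : 0 < δ := hδ0
  rw [Real.dist_eq]
  refine lt_of_le_of_lt (le_of_tendsto (((hs δ hδ0).hasSum.tendsto_sum_nat).sub_const β).abs ?_) hδ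
  filter_upwards [eventually_ge_atTop M] with N hN
  refine abs_sum_mul_sub_le (v := fun k : ℕ => ((k : ℝ) + 1) ^ (-δ)) (half_pos hε).le hN (by simp)
    (fun m n hmn => ?_) (by positivity) hK fun n hn => (hM n hn).le
  exact rpow_le_rpow_of_nonpos (by positivity) (by gcongr) (by linarith)

/-- The Euler factor weight `-log (1 - m ^ (-s))`. -/
noncomputable def eulerLog (m : ℕ) (s : ℝ) : ℝ := -Real.log (1 - (m : ℝ) ^ (-s))

theorem rpow_neg_le_inv {m : ℕ} (hm : 2 ≤ m) {s : ℝ} (hs : 1 ≤ s) : (m : ℝ) ^ (-s) ≤ (m : ℝ)⁻¹ := by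
  rw [← rpow_neg_one]
  exact rpow_le_rpow_of_exponent_le (by exact_mod_cast (by omega : 1 ≤ m)) (by linarith)

theorem rpow_neg_le_half {m : ℕ} (hm : 2 ≤ m) {s : ℝ} (hs : 1 ≤ s) : (m : ℝ) ^ (-s) ≤ 1 / 2 := by
  refine (rpow_neg_le_inv hm hs).trans ?_
  rw [one_div]
  exact inv_anti₀ two_pos (by exact_mod_cast hm)

theorem abs_eulerLog_sub_le {m : ℕ} (hm : 2 ≤ m) {s : ℝ} (hs : 1 ≤ s) :
    |eulerLog m s - (m : ℝ) ^ (-s)| ≤ 2 * ((m : ℝ) ^ 2)⁻¹ := by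
  set x := (m : ℝ) ^ (-s) with hx
  have hx0 : 0 ≤ x := by positivity
  have hx1 : x ≤ 1 / 2 := rpow_neg_le_half hm hs
  have h := Real.abs_log_sub_add_sum_range_le (x := x) (by rw [abs_of_nonneg hx0]; linarith) 1
  rw [abs_of_nonneg hx0] at h
  simp only [Finset.sum_range_one, zero_add, pow_one, Nat.cast_zero, div_one] at h
  rw [eulerLog, abs_sub_comm, sub_neg_eq_add]
  refine h.trans ?_
  rw [div_le_iff₀ (by linarith)]
  have hsq : x ^ (1 + 1) ≤ ((m : ℝ) ^ 2)⁻¹ := by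
    rw [← inv_pow]
    exact pow_le_pow_left₀ hx0 (rpow_neg_le_inv hm hs) 2
  have : 0 ≤ ((m : ℝ) ^ 2)⁻¹ := by positivity
  nlinarith

theorem tendsto_eulerLog_sub {m : ℕ} (hm : 2 ≤ m) :
    Tendsto (fun δ : ℝ => eulerLog m (1 + δ) - (m : ℝ) ^ (-(1 + δ))) (𝓝[>] 0)
      (𝓝 (eulerWeight m - (m : ℝ)⁻¹)) := by
  have hc : Tendsto (fun δ : ℝ => (m : ℝ) ^ (-(1 + δ))) (𝓝[>] 0) (𝓝 (m : ℝ)⁻¹) := by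
    have h1 : Continuous fun δ : ℝ => (m : ℝ) ^ (-(1 + δ)) :=
      (Real.continuous_const_rpow (by positivity)).comp (by fun_prop)
    have := (h1.tendsto 0).mono_left (nhdsWithin_le_nhds (s := Set.Ioi 0))
    simpa [rpow_neg_one] using this
  have hne : 1 - (m : ℝ)⁻¹ ≠ 0 := by
    have : (m : ℝ)⁻¹ ≤ 2⁻¹ := inv_anti₀ two_pos (by exact_mod_cast hm)
    linarith
  have h2 := ((hc.const_sub 1).log hne).neg.sub hc
  simpa [eulerLog, eulerWeight, one_div] using h2

theorem tendsto_tsum_mul_eulerLog {c : ℕ → ℝ} {α : ℝ} (hc : ∀ m, |c m| ≤ 1)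
    (hc2 : ∀ m < 2, c m = 0)
    (h : Tendsto (fun N => ∑ m ∈ Finset.range N, c m * eulerWeight m) atTop (𝓝 α)) :
    Tendsto (fun δ : ℝ => ∑' m, c m * eulerLog m (1 + δ)) (𝓝[>] 0) (𝓝 α) := by
  have hbound : Summable fun m : ℕ => 2 * ((m : ℝ) ^ 2)⁻¹ :=
    (Real.summable_nat_pow_inv.2 one_lt_two).mul_left 2
  have hle : ∀ (m : ℕ) (s : ℝ), 1 ≤ s → ‖c m * (eulerLog m s - (m : ℝ) ^ (-s))‖ ≤
      2 * ((m : ℝ) ^ 2)⁻¹ := by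
    intro m s hs
    rcases lt_or_ge m 2 with hm | hm
    · rw [hc2 m hm, zero_mul, norm_zero]; positivity
    · rw [norm_mul]
      exact (mul_le_of_le_one_left (norm_nonneg _) (hc m)).trans (abs_eulerLog_sub_le hm hs)
  have hone : ∀ m : ℕ, eulerLog m 1 - (m : ℝ) ^ (-1 : ℝ) = eulerWeight m - (m : ℝ)⁻¹ := fun m => by
    rw [eulerLog, eulerWeight, rpow_neg_one, one_div]
  have hs1 : Summable fun m : ℕ => c m * (eulerWeight m - (m : ℝ)⁻¹) := by
    refine hbound.of_norm_bounded fun m => ?_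
    rw [← hone]
    exact hle m 1 le_rfl
  have hres : Tendsto (fun δ : ℝ => ∑' m : ℕ, c m * (eulerLog m (1 + δ) - (m : ℝ) ^ (-(1 + δ))))
      (𝓝[>] 0) (𝓝 (∑' m : ℕ, c m * (eulerWeight m - (m : ℝ)⁻¹))) := by
    refine tendsto_tsum_of_dominated_convergence hbound (fun m => ?_) ?_
    · rcases lt_or_ge m 2 with hm | hm
      · simp [hc2 m hm]
      · exact (tendsto_eulerLog_sub hm).const_mul _
    · filter_upwards [self_mem_nhdsWithin] with δ hδ m
      exact hle m _ (by linarith [Set.mem_Ioi.1 hδ])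
  have hsum1 : Tendsto (fun N => ∑ m ∈ Finset.range N, c m * (m : ℝ)⁻¹) atTop
      (𝓝 (α - ∑' m : ℕ, c m * (eulerWeight m - (m : ℝ)⁻¹))) := by
    refine (h.sub hs1.hasSum.tendsto_sum_nat).congr fun N => ?_
    rw [← Finset.sum_sub_distrib]
    exact Finset.sum_congr rfl fun m _ => by ring
  have hshift : Tendsto (fun N => ∑ k ∈ Finset.range N, c (k + 1) * ((k + 1 : ℕ) : ℝ)⁻¹) atTop
      (𝓝 (α - ∑' m : ℕ, c m * (eulerWeight m - (m : ℝ)⁻¹))) := by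
    refine (hsum1.comp (tendsto_add_atTop_nat 1)).congr fun N => ?_
    rw [Function.comp, Finset.sum_range_succ', hc2 0 two_pos, zero_mul, add_zero]
  have hsummable : ∀ δ : ℝ, 0 < δ → Summable fun m : ℕ => c m * (m : ℝ) ^ (-(1 + δ)) := by
    intro δ hδ
    refine Summable.of_norm_bounded (Real.summable_nat_rpow.2 (by linarith : -(1 + δ) < -1))
      fun m => ?_
    rw [norm_mul, Real.norm_of_nonneg (by positivity : 0 ≤ (m : ℝ) ^ (-(1 + δ)))]
    exact mul_le_of_le_one_left (by positivity) (hc m)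
  have hterm : ∀ (δ : ℝ) (k : ℕ), c (k + 1) * ((k + 1 : ℕ) : ℝ)⁻¹ * ((k : ℝ) + 1) ^ (-δ) =
      c (k + 1) * ((k + 1 : ℕ) : ℝ) ^ (-(1 + δ)) := by
    intro δ k
    push_cast
    rw [neg_add, rpow_add (by positivity), rpow_neg_one]
    ring
  have habel := tendsto_tsum_mul_rpow_of_tendsto_sum hshift fun δ hδ => by
    simp only [hterm]
    exact (summable_nat_add_iff 1).2 (hsummable δ hδ)
  have := habel.add hres
  rw [sub_add_cancel] at this
  refine this.congr' ?_
  filter_upwards [self_mem_nhdsWithin] with δ hδ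
  have hδ : 0 < δ := hδ
  simp only [hterm]
  have h0 := (hsummable δ hδ).tsum_eq_zero_add
  rw [hc2 0 two_pos, zero_mul, zero_add] at h0
  rw [← h0, ← (hsummable δ hδ).tsum_add
    (hbound.of_norm_bounded fun m => hle m _ (by linarith))]
  exact tsum_congr fun m => by ring

end AbelSummation

section PrimeSupported
open Topology

/-- The positive integers all of whose prime factors satisfy `P`. -/
def primeSupported (P : ℕ → Prop) : Set ℕ := {n | n ≠ 0 ∧ ∀ p, p.Prime → p ∣ n → P p}

variable {P : ℕ → Prop}

theorem zero_notMem_primeSupported : 0 ∉ primeSupported P := fun h => h.1 rfl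

theorem one_mem_primeSupported : 1 ∈ primeSupported P :=
  ⟨one_ne_zero, fun _ hp h => absurd (Nat.dvd_one.1 h) hp.ne_one⟩

theorem mul_mem_primeSupported_iff {m n : ℕ} :
    m * n ∈ primeSupported P ↔ m ∈ primeSupported P ∧ n ∈ primeSupported P := by
  constructor
  · rintro ⟨h0, h⟩
    exact ⟨⟨left_ne_zero_of_mul h0, fun p hp hd => h p hp (hd.mul_right n)⟩,
      ⟨right_ne_zero_of_mul h0, fun p hp hd => h p hp (hd.mul_left m)⟩⟩
  · rintro ⟨⟨hm, hm1⟩, ⟨hn, hn1⟩⟩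
    exact ⟨mul_ne_zero hm hn, fun p hp hd => (hp.dvd_mul.1 hd).elim (hm1 p hp) (hn1 p hp)⟩

theorem prime_mem_primeSupported_iff {p : ℕ} (hp : p.Prime) : p ∈ primeSupported P ↔ P p :=
  ⟨fun h => h.2 p hp dvd_rfl, fun h => ⟨hp.ne_zero, fun q hq hd => by
    rwa [(Nat.prime_dvd_prime_iff_eq hq hp).1 hd]⟩⟩

open Classical in
/-- The indicator function of `primeSupported P`. -/
noncomputable def supportedInd (P : ℕ → Prop) : ℕ →*₀ ℝ where
  toFun n := if n ∈ primeSupported P then 1 else 0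
  map_zero' := if_neg zero_notMem_primeSupported
  map_one' := if_pos one_mem_primeSupported
  map_mul' m n := by
    simp only [mul_mem_primeSupported_iff]
    split_ifs <;> simp_all

theorem supportedInd_of_mem {n : ℕ} (h : n ∈ primeSupported P) : supportedInd P n = 1 := if_pos h

theorem supportedInd_of_notMem {n : ℕ} (h : n ∉ primeSupported P) : supportedInd P n = 0 :=
  if_neg h

theorem supportedInd_nonneg (n : ℕ) : 0 ≤ supportedInd P n := by
  by_cases h : n ∈ primeSupported P
  · rw [supportedInd_of_mem h]; exact zero_le_one
  · rw [supportedInd_of_notMem h]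

theorem supportedInd_le_one (n : ℕ) : supportedInd P n ≤ 1 := by
  by_cases h : n ∈ primeSupported P
  · rw [supportedInd_of_mem h]
  · rw [supportedInd_of_notMem h]; exact zero_le_one

/-- The completely multiplicative function `n ↦ n ^ (-s)`, supported on `primeSupported P`. -/
noncomputable def supportedRpow (P : ℕ → Prop) (s : ℝ) : ℕ →*₀ ℝ where
  toFun n := supportedInd P n * (n : ℝ) ^ (-s)
  map_zero' := by simp
  map_one' := by simp
  map_mul' m n := by
    rw [map_mul, Nat.cast_mul, mul_rpow m.cast_nonneg n.cast_nonneg]; ring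

theorem supportedRpow_apply (s : ℝ) (n : ℕ) :
    supportedRpow P s n = supportedInd P n * (n : ℝ) ^ (-s) := rfl

theorem summable_supportedInd_mul_rpow {s : ℝ} (hs : 1 < s) :
    Summable fun n : ℕ => supportedInd P n * (n : ℝ) ^ (-s) :=
  Summable.of_nonneg_of_le (fun n => mul_nonneg (supportedInd_nonneg n) (by positivity))
    (fun n => mul_le_of_le_one_left (by positivity) (supportedInd_le_one n))
    (Real.summable_nat_rpow.2 (by linarith : -s < -1))

theorem summable_prime_eulerLog {s : ℝ} (hs : 1 < s) :
    Summable fun m : ℕ => if m.Prime then eulerLog m s else 0 := by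
  have h1 : Summable fun m : ℕ => (m : ℝ) ^ (-s) + 2 * ((m : ℝ) ^ 2)⁻¹ :=
    (Real.summable_nat_rpow.2 (by linarith : -s < -1)).add
      ((Real.summable_nat_pow_inv.2 one_lt_two).mul_left 2)
  refine h1.of_norm_bounded fun m => ?_
  split_ifs with hm
  · have h2 := abs_eulerLog_sub_le hm.two_le hs.le
    have h3 : 0 ≤ (m : ℝ) ^ (-s) := by positivity
    rw [Real.norm_eq_abs]
    rw [abs_le] at *
    constructor <;> linarith [h2.1, h2.2]
  · rw [norm_zero]; positivity

theorem tsum_supportedInd_mul_rpow [DecidablePred P] {s : ℝ} (hs : 1 < s) :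
    ∑' n : ℕ, supportedInd P n * (n : ℝ) ^ (-s) =
      exp (∑' m : ℕ, if m.Prime then (if P m then eulerLog m s else 0) else 0) := by
  have hsum : Summable fun m : ℕ => if m.Prime then (if P m then eulerLog m s else 0) else 0 := by
    refine (summable_prime_eulerLog hs).norm.of_norm_bounded fun m => ?_
    split_ifs <;> simp
  have h1 : HasProd (fun p : Nat.Primes => (1 - supportedRpow P s p)⁻¹)
      (∑' n, supportedRpow P s n) := by
    refine EulerProduct.eulerProduct_completely_multiplicative_hasProd ?_
    exact (summable_supportedInd_mul_rpow hs).norm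
  have hind : (fun m : ℕ => if m.Prime then (if P m then eulerLog m s else 0) else 0) =
      {m | m.Prime}.indicator fun m => if P m then eulerLog m s else 0 := by
    ext m; simp [Set.indicator_apply]
  have h2 : HasSum (fun p : Nat.Primes => if P p then eulerLog p s else 0)
      (∑' m : ℕ, if m.Prime then (if P m then eulerLog m s else 0) else 0) := by
    have := hsum.hasSum
    nth_rewrite 1 [hind] at this
    exact hasSum_subtype_iff_indicator.2 this
  refine h1.unique ?_
  convert h2.rexp using 1
  ext p
  have hp := p.2
  simp only [Function.comp, supportedRpow_apply]
  split_ifs with hP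
  · rw [supportedInd_of_mem ((prime_mem_primeSupported_iff hp).2 hP), one_mul, eulerLog, exp_neg,
      exp_log]
    have := rpow_neg_le_half hp.two_le hs.le
    linarith
  · rw [supportedInd_of_notMem fun h => hP ((prime_mem_primeSupported_iff hp).1 h)]
    simp

theorem tendsto_mul_tsum_rpow :
    Tendsto (fun δ : ℝ => δ * ∑' n : ℕ, (n : ℝ) ^ (-(1 + δ))) (𝓝[>] 0) (𝓝 1) := by
  have h : Tendsto (fun δ : ℝ => 1 + δ) (𝓝[>] 0) (𝓝[>] 1) := by
    refine tendsto_nhdsWithin_iff.2 ⟨?_, ?_⟩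
    · have : Continuous fun δ : ℝ => 1 + δ := by fun_prop
      simpa using (this.tendsto 0).mono_left (nhdsWithin_le_nhds (s := Set.Ioi 0))
    · filter_upwards [self_mem_nhdsWithin] with δ hδ
      simpa using hδ
  refine (tendsto_sub_mul_tsum_nat_rpow.comp h).congr fun δ => ?_
  simp only [Function.comp, add_sub_cancel_left]
  congr 1
  exact tsum_congr fun n => by rw [one_div, rpow_neg n.cast_nonneg]

theorem tendsto_rpow_mul_tsum_supportedInd [DecidablePred P] {τ a : ℝ} (hτ : τ ∈ Set.Ioo (0 : ℝ) 1)
    (ha : 0 < a)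
    (h : Tendsto (fun N : ℕ => ∑ m ∈ Finset.range N,
      if m.Prime then ((if P m then 1 else 0) - τ) * eulerWeight m else 0) atTop (𝓝 (log a))) :
    Tendsto (fun δ : ℝ => δ ^ τ * ∑' n : ℕ, supportedInd P n * (n : ℝ) ^ (-(1 + δ)))
      (𝓝[>] 0) (𝓝 a) := by
  set c : ℕ → ℝ := fun m => if m.Prime then (if P m then 1 else 0) - τ else 0 with hc
  have h1 : Tendsto (fun δ : ℝ => ∑' m, c m * eulerLog m (1 + δ)) (𝓝[>] 0) (𝓝 (log a)) := by
    refine tendsto_tsum_mul_eulerLog (fun m => ?_) (fun m hm => ?_) (h.congr fun N => ?_)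
    · simp only [hc]
      rw [abs_le]
      split_ifs <;> constructor <;> linarith [hτ.1, hτ.2]
    · exact if_neg fun hp => absurd hp.two_le (by omega)
    · exact Finset.sum_congr rfl fun m _ => by simp only [hc]; split_ifs <;> simp
  have h2 := h1.rexp
  rw [exp_log ha] at h2
  have h3 := (tendsto_mul_tsum_rpow.rpow_const (p := τ) (Or.inl one_ne_zero)).mul h2
  rw [one_rpow, one_mul] at h3
  refine h3.congr' ?_
  filter_upwards [self_mem_nhdsWithin] with δ hδ
  have hδ : 0 < δ := hδ
  have hs : 1 < 1 + δ := by linarith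
  have hS := summable_prime_eulerLog hs
  have hSP : Summable fun m : ℕ =>
      if m.Prime then (if P m then eulerLog m (1 + δ) else 0) else 0 := by
    refine hS.norm.of_norm_bounded fun m => ?_
    split_ifs <;> simp
  have hZ : ∑' n : ℕ, (n : ℝ) ^ (-(1 + δ)) =
      exp (∑' m : ℕ, if m.Prime then eulerLog m (1 + δ) else 0) := by
    have := tsum_supportedInd_mul_rpow (P := fun _ => True) hs
    simp only [if_true] at this
    rw [← this]
    refine tsum_congr fun n => ?_
    rcases eq_or_ne n 0 with rfl | hn
    · rw [Nat.cast_zero, zero_rpow (by linarith : -(1 + δ) ≠ 0), mul_zero]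
    · rw [supportedInd_of_mem ⟨hn, fun _ _ _ => trivial⟩, one_mul]
  have hcs : ∑' m, c m * eulerLog m (1 + δ) =
      (∑' m : ℕ, if m.Prime then (if P m then eulerLog m (1 + δ) else 0) else 0) -
        τ * ∑' m : ℕ, if m.Prime then eulerLog m (1 + δ) else 0 := by
    rw [← tsum_mul_left, ← hSP.tsum_sub (hS.mul_left τ)]
    refine tsum_congr fun m => ?_
    simp only [hc]
    split_ifs <;> ring
  rw [tsum_supportedInd_mul_rpow hs, hZ, hcs, mul_rpow hδ.le (exp_pos _).le, ← exp_mul, mul_assoc,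
    ← exp_add]
  congr 2
  ring

end PrimeSupported

section Karamata
open Topology MeasureTheory

/-- The Gamma density `exp (-t) * t ^ (τ - 1)`. -/
noncomputable def gammaWeight (τ t : ℝ) : ℝ := exp (-t) * t ^ (τ - 1)

/-- The integral of `g (exp (-t))` against the Gamma density. -/
noncomputable def gammaMean (τ : ℝ) (g : ℝ → ℝ) : ℝ :=
  ∫ t in Set.Ioi (0 : ℝ), g (exp (-t)) * gammaWeight τ t

/-- The rescaled Dirichlet sum of `g (n ^ (-δ))`. -/
noncomputable def dirichletMean (μ : ℕ → ℝ) (τ δ : ℝ) (g : ℝ → ℝ) : ℝ :=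
  δ ^ τ * ∑' n : ℕ, μ n * (n : ℝ) ^ (-δ) * g ((n : ℝ) ^ (-δ))

theorem natCast_rpow_neg_mem_Icc (n : ℕ) {δ : ℝ} (hδ : 0 < δ) :
    (n : ℝ) ^ (-δ) ∈ Set.Icc (0 : ℝ) 1 := by
  refine ⟨by positivity, ?_⟩
  rcases Nat.eq_zero_or_pos n with rfl | hn
  · rw [Nat.cast_zero, zero_rpow (by linarith)]; exact zero_le_one
  · exact rpow_le_one_of_one_le_of_nonpos (by exact_mod_cast hn) (by linarith)

theorem exp_neg_mem_Icc {t : ℝ} (ht : t ∈ Set.Ioi (0 : ℝ)) : exp (-t) ∈ Set.Icc (0 : ℝ) 1 :=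
  ⟨(exp_pos _).le, exp_le_one_iff.2 (neg_nonpos.2 (le_of_lt ht))⟩

theorem gammaWeight_nonneg (τ : ℝ) {t : ℝ} (ht : t ∈ Set.Ioi (0 : ℝ)) : 0 ≤ gammaWeight τ t :=
  mul_nonneg (exp_pos _).le (rpow_nonneg (le_of_lt ht) _)

theorem integrableOn_gammaWeight {τ : ℝ} (hτ : 0 < τ) :
    IntegrableOn (gammaWeight τ) (Set.Ioi 0) := Real.GammaIntegral_convergent hτ

theorem integrableOn_mul_gammaWeight {τ : ℝ} (hτ : 0 < τ) {g : ℝ → ℝ} (hg : Measurable g) {C : ℝ}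
    (hC : ∀ x ∈ Set.Icc (0 : ℝ) 1, |g x| ≤ C) :
    IntegrableOn (fun t => g (exp (-t)) * gammaWeight τ t) (Set.Ioi 0) := by
  refine (integrableOn_gammaWeight hτ).bdd_mul (c := C)
    (hg.comp (by fun_prop)).aestronglyMeasurable ?_
  filter_upwards [ae_restrict_mem measurableSet_Ioi] with t ht
  exact hC _ (exp_neg_mem_Icc ht)

theorem exists_abs_le_of_continuous {g : ℝ → ℝ} (hg : Continuous g) :
    ∃ C, ∀ x ∈ Set.Icc (0 : ℝ) 1, |g x| ≤ C :=
  isCompact_Icc.exists_bound_of_continuousOn hg.continuousOn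

variable {μ : ℕ → ℝ} {τ a : ℝ}

theorem summable_mul_rpow_mul (hμ : ∀ n, 0 ≤ μ n)
    (hs : ∀ δ : ℝ, 0 < δ → Summable fun n : ℕ => μ n * (n : ℝ) ^ (-δ)) {g : ℝ → ℝ} {C : ℝ}
    (hC : ∀ x ∈ Set.Icc (0 : ℝ) 1, |g x| ≤ C) {δ : ℝ} (hδ : 0 < δ) :
    Summable fun n : ℕ => μ n * (n : ℝ) ^ (-δ) * g ((n : ℝ) ^ (-δ)) := by
  refine ((hs δ hδ).mul_right C).of_norm_bounded fun n => ?_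
  have h0 : 0 ≤ μ n * (n : ℝ) ^ (-δ) := mul_nonneg (hμ n) (by positivity)
  rw [norm_mul, Real.norm_of_nonneg h0]
  exact mul_le_mul_of_nonneg_left (hC _ (natCast_rpow_neg_mem_Icc n hδ)) h0

theorem dirichletMean_mono (hμ : ∀ n, 0 ≤ μ n)
    (hs : ∀ δ : ℝ, 0 < δ → Summable fun n : ℕ => μ n * (n : ℝ) ^ (-δ)) {f g : ℝ → ℝ} {C D : ℝ}
    (hC : ∀ x ∈ Set.Icc (0 : ℝ) 1, |f x| ≤ C) (hD : ∀ x ∈ Set.Icc (0 : ℝ) 1, |g x| ≤ D)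
    (hfg : ∀ x ∈ Set.Icc (0 : ℝ) 1, f x ≤ g x) {δ : ℝ} (hδ : 0 < δ) :
    dirichletMean μ τ δ f ≤ dirichletMean μ τ δ g := by
  refine mul_le_mul_of_nonneg_left ?_ (by positivity)
  refine (summable_mul_rpow_mul hμ hs hC hδ).tsum_le_tsum (fun n => ?_)
    (summable_mul_rpow_mul hμ hs hD hδ)
  exact mul_le_mul_of_nonneg_left (hfg _ (natCast_rpow_neg_mem_Icc n hδ))
    (mul_nonneg (hμ n) (by positivity))

theorem dirichletMean_add (hμ : ∀ n, 0 ≤ μ n)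
    (hs : ∀ δ : ℝ, 0 < δ → Summable fun n : ℕ => μ n * (n : ℝ) ^ (-δ)) {f g : ℝ → ℝ}
    (hf : Continuous f) (hg : Continuous g) {δ : ℝ} (hδ : 0 < δ) :
    dirichletMean μ τ δ (fun x => f x + g x) =
      dirichletMean μ τ δ f + dirichletMean μ τ δ g := by
  obtain ⟨C, hC⟩ := exists_abs_le_of_continuous hf
  obtain ⟨D, hD⟩ := exists_abs_le_of_continuous hg
  simp only [dirichletMean]
  rw [← mul_add, ← (summable_mul_rpow_mul hμ hs hC hδ).tsum_add
    (summable_mul_rpow_mul hμ hs hD hδ)]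
  simp only [mul_add]

theorem gammaMean_add (hτ : 0 < τ) {f g : ℝ → ℝ} (hf : Continuous f) (hg : Continuous g) :
    gammaMean τ (fun x => f x + g x) = gammaMean τ f + gammaMean τ g := by
  obtain ⟨C, hC⟩ := exists_abs_le_of_continuous hf
  obtain ⟨D, hD⟩ := exists_abs_le_of_continuous hg
  simp only [gammaMean, add_mul]
  exact integral_add (integrableOn_mul_gammaWeight hτ hf.measurable hC)
    (integrableOn_mul_gammaWeight hτ hg.measurable hD)

theorem gammaMean_mono (hτ : 0 < τ) {f g : ℝ → ℝ} (hf : Continuous f) (hg : Continuous g)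
    (hfg : ∀ x ∈ Set.Icc (0 : ℝ) 1, f x ≤ g x) : gammaMean τ f ≤ gammaMean τ g := by
  obtain ⟨C, hC⟩ := exists_abs_le_of_continuous hf
  obtain ⟨D, hD⟩ := exists_abs_le_of_continuous hg
  refine setIntegral_mono_on (integrableOn_mul_gammaWeight hτ hf.measurable hC)
    (integrableOn_mul_gammaWeight hτ hg.measurable hD) measurableSet_Ioi fun t ht => ?_
  exact mul_le_mul_of_nonneg_right (hfg _ (exp_neg_mem_Icc ht)) (gammaWeight_nonneg τ ht)

theorem gammaMean_mul_pow (hτ : 0 < τ) (c : ℝ) (k : ℕ) :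
    gammaMean τ (fun x => c * x ^ k) = c * ((k + 1 : ℝ) ^ (-τ) * Gamma τ) := by
  have h := Real.integral_rpow_mul_exp_neg_mul_Ioi hτ (by positivity : (0 : ℝ) < k + 1)
  rw [one_div, inv_rpow (by positivity), ← rpow_neg (by positivity)] at h
  rw [← h, gammaMean, ← integral_const_mul]
  congr 1; ext t
  rw [gammaWeight, ← exp_nat_mul, mul_assoc, ← mul_assoc (exp _), ← exp_add, mul_comm (exp _)]
  congr 4
  ring

theorem dirichletMean_mul_pow (c : ℝ) (k : ℕ) {δ : ℝ} (hδ : 0 < δ) :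
    dirichletMean μ τ δ (fun x => c * x ^ k) = c * ((k + 1 : ℝ) ^ (-τ) *
      (((k + 1 : ℝ) * δ) ^ τ * ∑' n : ℕ, μ n * (n : ℝ) ^ (-((k + 1 : ℝ) * δ)))) := by
  have hk : (0 : ℝ) < k + 1 := by positivity
  have h1 : ∀ n : ℕ, μ n * (n : ℝ) ^ (-δ) * (c * ((n : ℝ) ^ (-δ)) ^ k) =
      c * (μ n * (n : ℝ) ^ (-((k + 1 : ℝ) * δ))) := fun n => by
    have : (n : ℝ) ^ (-((k + 1 : ℝ) * δ)) = ((n : ℝ) ^ (-δ)) ^ (k + 1) := by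
      rw [← rpow_mul_natCast n.cast_nonneg]
      congr 1; push_cast; ring
    rw [this, pow_succ]; ring
  have h2 : (k + 1 : ℝ) ^ (-τ) * (k + 1 : ℝ) ^ τ = 1 := by
    rw [← rpow_add hk, neg_add_cancel, rpow_zero]
  rw [dirichletMean]
  simp only [h1]
  rw [tsum_mul_left, mul_rpow hk.le hδ.le]
  linear_combination -(δ ^ τ * c * ∑' n : ℕ, μ n * (n : ℝ) ^ (-((k + 1 : ℝ) * δ))) * h2

theorem tendsto_dirichletMean_polynomial (hτ : 0 < τ) (hμ : ∀ n, 0 ≤ μ n)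
    (hs : ∀ δ : ℝ, 0 < δ → Summable fun n : ℕ => μ n * (n : ℝ) ^ (-δ))
    (h : Tendsto (fun δ : ℝ => δ ^ τ * ∑' n : ℕ, μ n * (n : ℝ) ^ (-δ)) (𝓝[>] 0) (𝓝 a))
    (p : Polynomial ℝ) :
    Tendsto (fun δ => dirichletMean μ τ δ fun x => p.eval x) (𝓝[>] 0)
      (𝓝 (a / Gamma τ * gammaMean τ fun x => p.eval x)) := by
  induction p using Polynomial.induction_on' with
  | add p q hp hq =>
    simp only [Polynomial.eval_add]
    rw [gammaMean_add hτ p.continuous q.continuous, mul_add]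
    refine (hp.add hq).congr' ?_
    filter_upwards [self_mem_nhdsWithin] with δ hδ
    exact (dirichletMean_add hμ hs p.continuous q.continuous hδ).symm
  | monomial k c =>
    simp only [Polynomial.eval_monomial]
    rw [gammaMean_mul_pow hτ]
    have hk : (0 : ℝ) < k + 1 := by positivity
    have hmul : Tendsto (fun δ : ℝ => (k + 1 : ℝ) * δ) (𝓝[>] 0) (𝓝[>] 0) := by
      refine tendsto_nhdsWithin_iff.2 ⟨?_, ?_⟩
      · have : Continuous fun δ : ℝ => (k + 1 : ℝ) * δ := by fun_prop
        simpa using (this.tendsto 0).mono_left (nhdsWithin_le_nhds (s := Set.Ioi 0))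
      · filter_upwards [self_mem_nhdsWithin] with δ hδ
        exact mul_pos hk hδ
    have h1 := ((h.comp hmul).const_mul ((k + 1 : ℝ) ^ (-τ))).const_mul c
    have hG := (Gamma_pos_of_pos hτ).ne'
    rw [show a / Gamma τ * (c * ((k + 1 : ℝ) ^ (-τ) * Gamma τ)) = c * ((k + 1 : ℝ) ^ (-τ) * a) by
      field_simp]
    refine h1.congr' ?_
    filter_upwards [self_mem_nhdsWithin] with δ hδ
    exact (dirichletMean_mul_pow c k hδ).symm

theorem tendsto_dirichletMean_continuous (hτ : 0 < τ) (hμ : ∀ n, 0 ≤ μ n)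
    (hs : ∀ δ : ℝ, 0 < δ → Summable fun n : ℕ => μ n * (n : ℝ) ^ (-δ)) (ha : 0 ≤ a)
    (h : Tendsto (fun δ : ℝ => δ ^ τ * ∑' n : ℕ, μ n * (n : ℝ) ^ (-δ)) (𝓝[>] 0) (𝓝 a))
    {g : ℝ → ℝ} (hg : Continuous g) :
    Tendsto (fun δ => dirichletMean μ τ δ g) (𝓝[>] 0) (𝓝 (a / Gamma τ * gammaMean τ g)) := by
  have hA : 0 ≤ a / Gamma τ := div_nonneg ha (Gamma_pos_of_pos hτ).le
  obtain ⟨C, hC⟩ := exists_abs_le_of_continuous hg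
  have key : ∀ ε > 0, ∃ p q : Polynomial ℝ, (∀ x ∈ Set.Icc (0 : ℝ) 1, p.eval x ≤ g x) ∧
      (∀ x ∈ Set.Icc (0 : ℝ) 1, g x ≤ q.eval x) ∧
      a / Gamma τ * (gammaMean τ g) - ε < a / Gamma τ * gammaMean τ (fun x => p.eval x) ∧
      a / Gamma τ * (gammaMean τ fun x => q.eval x) < a / Gamma τ * (gammaMean τ g) + ε := by
    intro ε hε
    set I := a / Gamma τ * gammaMean τ (fun _ => 1) with hI
    have hI0 : 0 ≤ I := by
      refine mul_nonneg hA (setIntegral_nonneg measurableSet_Ioi fun t ht => ?_)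
      rw [one_mul]; exact gammaWeight_nonneg τ ht
    set η := ε / (2 * I + 1) / 2 with hη
    have hη0 : 0 < η := by positivity
    have hηI : 2 * η * I < ε := by
      have : 2 * η * (2 * I + 1) = ε := by rw [hη]; field_simp
      nlinarith
    obtain ⟨p, hp⟩ := exists_polynomial_near_of_continuousOn 0 1 g hg.continuousOn η hη0
    have hconst : ∀ c : ℝ, a / Gamma τ * gammaMean τ (fun _ => c) = c * I := fun c => by
      have h1 := gammaMean_mul_pow hτ c 0
      have h2 := gammaMean_mul_pow hτ 1 0
      simp only [pow_zero, mul_one] at h1 h2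
      rw [hI, h1, h2]; ring
    refine ⟨p - Polynomial.C η, p + Polynomial.C η, fun x hx => ?_, fun x hx => ?_, ?_, ?_⟩
    · have := (abs_lt.1 (hp x hx)).2
      simp only [Polynomial.eval_sub, Polynomial.eval_C]; linarith
    · have := (abs_lt.1 (hp x hx)).1
      simp only [Polynomial.eval_add, Polynomial.eval_C]; linarith
    · have h1 := gammaMean_mono hτ (f := fun x => g x) (g := fun x =>
        (p - Polynomial.C η).eval x + 2 * η) hg (by fun_prop) fun x hx => by
          have := (abs_lt.1 (hp x hx)).1
          simp only [Polynomial.eval_sub, Polynomial.eval_C]; linarith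
      rw [gammaMean_add hτ (by fun_prop) (by fun_prop)] at h1
      have h2 := mul_le_mul_of_nonneg_left h1 hA
      rw [mul_add, hconst] at h2
      linarith
    · have h1 := gammaMean_mono hτ (g := fun x => g x + 2 * η) (f := fun x =>
        (p + Polynomial.C η).eval x) (by fun_prop) (by fun_prop) fun x hx => by
          have := (abs_lt.1 (hp x hx)).2
          simp only [Polynomial.eval_add, Polynomial.eval_C]; linarith
      rw [gammaMean_add hτ (by fun_prop) (by fun_prop)] at h1
      have h2 := mul_le_mul_of_nonneg_left h1 hA
      rw [mul_add, hconst] at h2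
      linarith
  refine tendsto_order.2 ⟨fun y hy => ?_, fun y hy => ?_⟩
  · obtain ⟨p, -, hp, -, hpI, -⟩ := key _ (sub_pos.2 hy)
    rw [sub_sub_cancel] at hpI
    obtain ⟨D, hD⟩ := exists_abs_le_of_continuous p.continuous
    filter_upwards [(tendsto_dirichletMean_polynomial hτ hμ hs h p).eventually_const_lt hpI,
      self_mem_nhdsWithin] with δ h1 hδ
    exact h1.trans_le (dirichletMean_mono hμ hs hD hC hp hδ)
  · obtain ⟨-, q, -, hq, -, hqI⟩ := key _ (sub_pos.2 hy)
    rw [add_sub_cancel] at hqI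
    obtain ⟨D, hD⟩ := exists_abs_le_of_continuous q.continuous
    filter_upwards [(tendsto_dirichletMean_polynomial hτ hμ hs h q).eventually_lt_const hqI,
      self_mem_nhdsWithin] with δ h1 hδ
    exact (dirichletMean_mono hμ hs hC hD hq hδ).trans_lt h1

/-- A continuous ramp from `0` at `s` to `1` at `s + η`, divided by `max x (b / 2)`. -/
noncomputable def rampInv (b s η x : ℝ) : ℝ := max 0 (min 1 ((x - s) / η)) / max x (b / 2)

/-- The function `1 / x` cut off below `b`. -/
noncomputable def cutInv (b x : ℝ) : ℝ := if b ≤ x then x⁻¹ else 0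

theorem continuous_rampInv {b : ℝ} (hb : 0 < b) (s η : ℝ) : Continuous (rampInv b s η) := by
  unfold rampInv
  refine Continuous.div (by fun_prop) (by fun_prop) fun x => ?_
  have : b / 2 ≤ max x (b / 2) := le_max_right _ _
  linarith

theorem rampInv_nonneg {b : ℝ} (hb : 0 < b) (s η x : ℝ) : 0 ≤ rampInv b s η x :=
  div_nonneg (le_max_left _ _) ((half_pos hb).le.trans (le_max_right _ _))

theorem rampInv_le {b : ℝ} (hb : 0 < b) (s η x : ℝ) : rampInv b s η x ≤ 2 / b := by
  rw [rampInv, div_le_div_iff₀ ((half_pos hb).trans_le (le_max_right _ _)) hb]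
  have h1 : max 0 (min 1 ((x - s) / η)) ≤ 1 := max_le zero_le_one (min_le_left _ _)
  have h2 : b / 2 ≤ max x (b / 2) := le_max_right _ _
  nlinarith

theorem rampInv_eq_inv {b s η x : ℝ} (hb : 0 < b) (hη : 0 < η) (hx : b ≤ x) (hs : s + η ≤ x) :
    rampInv b s η x = x⁻¹ := by
  rw [rampInv, min_eq_left ((one_le_div hη).2 (by linarith)), max_eq_right zero_le_one,
    max_eq_left (by linarith), one_div]

theorem rampInv_eq_zero {b s η x : ℝ} (hη : 0 < η) (hs : x ≤ s) : rampInv b s η x = 0 := by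
  rw [rampInv, max_eq_left, zero_div]
  exact (min_le_right _ _).trans (div_nonpos_of_nonpos_of_nonneg (by linarith) hη.le)

theorem rampInv_le_cutInv {b η : ℝ} (hb : 0 < b) (hη : 0 < η) (x : ℝ) :
    rampInv b b η x ≤ cutInv b x := by
  rw [cutInv]
  split_ifs with hx
  · rw [rampInv, max_eq_left (by linarith : b / 2 ≤ x), ← one_div]
    exact div_le_div_of_nonneg_right (max_le zero_le_one (min_le_left _ _)) (by linarith)
  · rw [rampInv_eq_zero hη (not_le.1 hx).le]

theorem cutInv_le_rampInv {b η : ℝ} (hb : 0 < b) (hη : 0 < η) (x : ℝ) :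
    cutInv b x ≤ rampInv b (b - η) η x := by
  rw [cutInv]
  split_ifs with hx
  · rw [rampInv_eq_inv hb hη hx (by linarith)]
  · exact rampInv_nonneg hb _ _ _

theorem abs_cutInv_le {b : ℝ} (hb : 0 < b) (x : ℝ) : |cutInv b x| ≤ b⁻¹ := by
  rw [cutInv]
  split_ifs with hx
  · rw [abs_of_nonneg (inv_nonneg.2 (hb.le.trans hx))]
    exact inv_anti₀ hb hx
  · rw [abs_zero]; positivity

theorem tendsto_gammaMean_rampInv (hτ : 0 < τ) {s : ℝ → ℝ}
    (hs : (s = fun _ => exp (-1)) ∨ s = fun η => exp (-1) - η) :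
    Tendsto (fun η => gammaMean τ (rampInv (exp (-1)) (s η) η)) (𝓝[>] 0)
      (𝓝 (gammaMean τ (cutInv (exp (-1))))) := by
  have hb := exp_pos (-1)
  refine tendsto_integral_filter_of_dominated_convergence
    (fun t => 2 / exp (-1) * gammaWeight τ t) (Eventually.of_forall fun η => ?_)
    (Eventually.of_forall fun η => ?_) ((integrableOn_gammaWeight hτ).const_mul _) ?_
  · exact ((continuous_rampInv hb _ _).measurable.comp
      (by fun_prop)).aestronglyMeasurable.mul (integrableOn_gammaWeight hτ).1
  · filter_upwards [ae_restrict_mem measurableSet_Ioi] with t ht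
    rw [norm_mul, Real.norm_of_nonneg (rampInv_nonneg hb _ _ _),
      Real.norm_of_nonneg (gammaWeight_nonneg τ ht)]
    exact mul_le_mul_of_nonneg_right (rampInv_le hb _ _ _) (gammaWeight_nonneg τ ht)
  · have hne : ∀ᵐ t : ℝ ∂(volume.restrict (Set.Ioi 0)), t ≠ 1 :=
      ae_restrict_of_ae (Measure.ae_ne volume 1)
    filter_upwards [hne] with t ht
    refine Tendsto.mul_const _ (tendsto_const_nhds.congr' ?_)
    have hxb : exp (-t) ≠ exp (-1) := fun h => ht (neg_injective (exp_injective h))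
    have hpos : 0 < |exp (-t) - exp (-1)| := abs_pos.2 (sub_ne_zero.2 hxb)
    filter_upwards [self_mem_nhdsWithin, mem_nhdsWithin_of_mem_nhds (Iio_mem_nhds hpos)]
      with η hη0 hη
    have hη0 : 0 < η := hη0
    have hη : η < |exp (-t) - exp (-1)| := hη
    rw [cutInv]
    split_ifs with hx
    · rw [abs_of_nonneg (sub_nonneg.2 hx)] at hη
      refine (rampInv_eq_inv hb hη0 hx ?_).symm
      rcases hs with rfl | rfl <;> simp only <;> linarith
    · have hx := not_le.1 hx
      rw [abs_of_neg (sub_neg.2 hx)] at hη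
      refine (rampInv_eq_zero hη0 ?_).symm
      rcases hs with rfl | rfl <;> simp only <;> linarith

theorem gammaMean_cutInv (hτ : 0 < τ) : gammaMean τ (cutInv (exp (-1))) = 1 / τ := by
  have h1 : ∀ t : ℝ, cutInv (exp (-1)) (exp (-t)) * gammaWeight τ t =
      (Set.Iic 1).indicator (fun t => t ^ (τ - 1)) t := by
    intro t
    rw [cutInv, gammaWeight, Set.indicator_apply]
    have hiff : exp (-1) ≤ exp (-t) ↔ t ∈ Set.Iic (1 : ℝ) := by
      rw [exp_le_exp, neg_le_neg_iff]; rfl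
    simp only [hiff]
    split_ifs with ht
    · rw [inv_mul_cancel_left₀ (exp_pos _).ne']
    · rw [zero_mul]
  rw [gammaMean]
  simp only [h1]
  rw [setIntegral_indicator measurableSet_Iic, Set.Ioi_inter_Iic,
    ← intervalIntegral.integral_of_le zero_le_one, integral_rpow (Or.inl (by linarith))]
  simp [zero_rpow hτ.ne']

theorem tendsto_dirichletMean_cutInv (hτ : 0 < τ) (hμ : ∀ n, 0 ≤ μ n)
    (hs : ∀ δ : ℝ, 0 < δ → Summable fun n : ℕ => μ n * (n : ℝ) ^ (-δ)) (ha : 0 ≤ a)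
    (h : Tendsto (fun δ : ℝ => δ ^ τ * ∑' n : ℕ, μ n * (n : ℝ) ^ (-δ)) (𝓝[>] 0) (𝓝 a)) :
    Tendsto (fun δ => dirichletMean μ τ δ (cutInv (exp (-1)))) (𝓝[>] 0)
      (𝓝 (a / Gamma τ * (1 / τ))) := by
  have hb := exp_pos (-1)
  rw [← gammaMean_cutInv hτ]
  have hbound : ∀ s η x : ℝ, |rampInv (exp (-1)) s η x| ≤ 2 / exp (-1) := fun s η x => by
    rw [abs_of_nonneg (rampInv_nonneg hb _ _ _)]
    exact rampInv_le hb _ _ _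
  refine tendsto_order.2 ⟨fun y hy => ?_, fun y hy => ?_⟩
  · obtain ⟨η, hη, hη0⟩ := ((((tendsto_gammaMean_rampInv hτ (Or.inl rfl)).const_mul
      (a / Gamma τ)).eventually_const_lt hy).and self_mem_nhdsWithin).exists
    filter_upwards [(tendsto_dirichletMean_continuous hτ hμ hs ha h
      (continuous_rampInv hb _ _)).eventually_const_lt hη, self_mem_nhdsWithin] with δ h1 hδ
    exact h1.trans_le (dirichletMean_mono hμ hs (fun x _ => hbound _ _ x)
      (fun x _ => abs_cutInv_le hb x) (fun x _ => rampInv_le_cutInv hb hη0 x) hδ)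
  · obtain ⟨η, hη, hη0⟩ := ((((tendsto_gammaMean_rampInv hτ (Or.inr rfl)).const_mul
      (a / Gamma τ)).eventually_lt_const hy).and self_mem_nhdsWithin).exists
    filter_upwards [(tendsto_dirichletMean_continuous hτ hμ hs ha h
      (continuous_rampInv hb _ _)).eventually_lt_const hη, self_mem_nhdsWithin] with δ h1 hδ
    exact (dirichletMean_mono hμ hs (fun x _ => abs_cutInv_le hb x) (fun x _ => hbound _ _ x)
      (fun x _ => cutInv_le_rampInv hb hη0 x) hδ).trans_lt h1

theorem dirichletMean_cutInv_eq {x : ℝ} (hx : 1 < x) :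
    dirichletMean μ τ (log x)⁻¹ (cutInv (exp (-1))) =
      (∑ n ∈ Finset.Icc 1 ⌊x⌋₊, μ n) / log x ^ τ := by
  have hlog := log_pos hx
  have hx0 : 0 < x := by linarith
  have hiff : ∀ n : ℕ, exp (-1) ≤ (n : ℝ) ^ (-(log x)⁻¹) ↔ n ∈ Finset.Icc 1 ⌊x⌋₊ := by
    intro n
    rw [Finset.mem_Icc]
    rcases Nat.eq_zero_or_pos n with rfl | hn
    · rw [Nat.cast_zero, zero_rpow (neg_ne_zero.2 (inv_ne_zero hlog.ne'))]
      simp [(exp_pos _).not_ge]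
    · have hn0 : (0 : ℝ) < n := by exact_mod_cast hn
      rw [rpow_def_of_pos hn0, exp_le_exp, mul_neg, neg_le_neg_iff, ← div_eq_mul_inv,
        div_le_one hlog, log_le_log_iff hn0 hx0, Nat.le_floor_iff hx0.le]
      exact ⟨fun h => ⟨hn, h⟩, fun h => h.2⟩
  rw [dirichletMean, inv_rpow hlog.le, inv_mul_eq_div]
  congr 1
  rw [tsum_eq_sum (s := Finset.Icc 1 ⌊x⌋₊)]
  · refine Finset.sum_congr rfl fun n hn => ?_
    have h1 := (hiff n).2 hn
    rw [cutInv, if_pos h1, mul_inv_cancel_right₀ ((exp_pos _).trans_le h1).ne']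
  · intro n hn
    rw [cutInv, if_neg fun h1 => hn ((hiff n).1 h1), mul_zero]

/-- The Hardy–Littlewood–Karamata Tauberian theorem for Dirichlet series. -/
theorem tendsto_sum_div_log_rpow (hτ : 0 < τ) (hμ : ∀ n, 0 ≤ μ n)
    (hs : ∀ δ : ℝ, 0 < δ → Summable fun n : ℕ => μ n * (n : ℝ) ^ (-δ)) (ha : 0 ≤ a)
    (h : Tendsto (fun δ : ℝ => δ ^ τ * ∑' n : ℕ, μ n * (n : ℝ) ^ (-δ)) (𝓝[>] 0) (𝓝 a)) :
    Tendsto (fun x : ℝ => (∑ n ∈ Finset.Icc 1 ⌊x⌋₊, μ n) / log x ^ τ) atTop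
      (𝓝 (a / Gamma τ * (1 / τ))) := by
  have hlim : Tendsto (fun x : ℝ => (log x)⁻¹) atTop (𝓝[>] 0) :=
    tendsto_inv_atTop_nhdsGT_zero.comp tendsto_log_atTop
  refine ((tendsto_dirichletMean_cutInv hτ hμ hs ha h).comp hlim).congr' ?_
  filter_upwards [eventually_gt_atTop 1] with x hx
  exact dirichletMean_cutInv_eq hx

end Karamata

section SupportedCount
open Topology

variable {P : ℕ → Prop}

/-- The Chebyshev function `ψ` restricted to `primeSupported P`. -/
noncomputable def supportedPsi (P : ℕ → Prop) (x : ℝ) : ℝ :=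
  ∑ n ∈ Finset.Ioc 0 ⌊x⌋₊, supportedInd P n * ArithmeticFunction.vonMangoldt n

theorem supportedPsi_nonneg (x : ℝ) : 0 ≤ supportedPsi P x := Finset.sum_nonneg fun n _ =>
  mul_nonneg (supportedInd_nonneg n) ArithmeticFunction.vonMangoldt_nonneg

theorem supportedPsi_le_psi (x : ℝ) : supportedPsi P x ≤ Chebyshev.psi x :=
  Finset.sum_le_sum fun n _ =>
    mul_le_of_le_one_left ArithmeticFunction.vonMangoldt_nonneg (supportedInd_le_one n)

theorem supportedPsi_sub_eq [DecidablePred P] (x : ℝ) :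
    supportedPsi P x - (∑ m ∈ Finset.range (⌊x⌋₊ + 1),
      if m.Prime then (if P m then Real.log m else 0) else 0) =
    ∑ n ∈ Finset.Ioc 0 ⌊x⌋₊ with ¬n.Prime,
      supportedInd P n * ArithmeticFunction.vonMangoldt n := by
  rw [Finset.sum_range_succ']
  simp only [Nat.not_prime_zero, if_false, add_zero]
  rw [Finset.range_eq_Ico, Finset.sum_Ico_add' (fun m : ℕ =>
    if m.Prime then (if P m then Real.log m else 0) else 0) 0 ⌊x⌋₊ 1]
  change supportedPsi P x - ∑ m ∈ Finset.Ioc 0 ⌊x⌋₊, _ = _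
  rw [supportedPsi, ← Finset.sum_sub_distrib, Finset.sum_filter]
  refine Finset.sum_congr rfl fun n _ => ?_
  by_cases hn : n.Prime
  · rw [if_pos hn, if_neg (not_not.2 hn), ArithmeticFunction.vonMangoldt_apply_prime hn]
    split_ifs with hP
    · rw [supportedInd_of_mem ((prime_mem_primeSupported_iff hn).2 hP), one_mul, sub_self]
    · rw [supportedInd_of_notMem fun h => hP ((prime_mem_primeSupported_iff hn).1 h)]
      simp
  · rw [if_neg hn, if_pos hn, sub_zero]

theorem tendsto_psi_sub_theta_div :
    Tendsto (fun x : ℝ => (Chebyshev.psi x - Chebyshev.theta x) / x) atTop (𝓝 0) := by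
  have := tendsto_psi_div.sub tendsto_theta_div
  rw [sub_self] at this
  exact this.congr fun x => (sub_div _ _ _).symm

theorem tendsto_supportedPsi_div [DecidablePred P] {τ : ℝ}
    (h : Tendsto (fun x : ℝ => (∑ m ∈ Finset.range (⌊x⌋₊ + 1),
      if m.Prime then (if P m then Real.log m else 0) else 0) / x) atTop (𝓝 τ)) :
    Tendsto (fun x : ℝ => supportedPsi P x / x) atTop (𝓝 τ) := by
  have h1 : Tendsto (fun x : ℝ => (supportedPsi P x - (∑ m ∈ Finset.range (⌊x⌋₊ + 1),
      if m.Prime then (if P m then Real.log m else 0) else 0)) / x) atTop (𝓝 0) := by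
    refine squeeze_zero' ?_ ?_ tendsto_psi_sub_theta_div
    · filter_upwards [eventually_ge_atTop 0] with x hx
      rw [supportedPsi_sub_eq]
      exact div_nonneg (Finset.sum_nonneg fun n _ =>
        mul_nonneg (supportedInd_nonneg n) ArithmeticFunction.vonMangoldt_nonneg) hx
    · filter_upwards [eventually_ge_atTop 0] with x hx
      rw [supportedPsi_sub_eq, Chebyshev.psi_sub_theta_eq_sum_not_prime]
      exact div_le_div_of_nonneg_right (Finset.sum_le_sum fun n _ => mul_le_of_le_one_left
        ArithmeticFunction.vonMangoldt_nonneg (supportedInd_le_one n)) hx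
  have := h1.add h
  rw [zero_add] at this
  refine this.congr fun x => ?_
  ring

theorem exists_abs_supportedPsi_sub_le {τ : ℝ} (hτ : 0 ≤ τ)
    (h : Tendsto (fun x : ℝ => supportedPsi P x / x) atTop (𝓝 τ)) {ε : ℝ} (hε : 0 < ε) :
    ∃ C, ∀ y, 0 ≤ y → |supportedPsi P y - τ * y| ≤ ε * y + C := by
  obtain ⟨Y, hY⟩ := eventually_atTop.1 ((Metric.tendsto_nhds.1 h ε hε).and (eventually_gt_atTop 0))
  have hY0 : 0 < Y := (hY Y le_rfl).2
  refine ⟨Chebyshev.psi Y + τ * Y, fun y hy => ?_⟩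
  have hC := Chebyshev.psi_nonneg Y
  have hC1 := mul_nonneg hτ hY0.le
  rcases le_or_gt Y y with hYy | hyY
  · obtain ⟨h1, h2⟩ := hY y hYy
    rw [Real.dist_eq] at h1
    have h3 : supportedPsi P y - τ * y = (supportedPsi P y / y - τ) * y := by field_simp
    rw [h3, abs_mul, abs_of_pos h2]
    have := mul_le_mul_of_nonneg_right h1.le h2.le
    linarith
  · have h1 := supportedPsi_nonneg (P := P) y
    have h2 := (supportedPsi_le_psi (P := P) y).trans (Chebyshev.psi_mono hyY.le)
    have h3 := mul_nonneg hε.le hy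
    have h4 := mul_le_mul_of_nonneg_left hyY.le hτ
    have h5 := mul_nonneg hτ hy
    rw [abs_le]
    constructor <;> linarith

theorem sum_supportedInd_mul_log (x : ℝ) :
    ∑ n ∈ Finset.Ioc 0 ⌊x⌋₊, supportedInd P n * Real.log n =
      ∑ n ∈ Finset.Ioc 0 ⌊x⌋₊, supportedInd P n * supportedPsi P (x / n) := by
  let F : ArithmeticFunction ℝ := ⟨supportedInd P, map_zero _⟩
  let G : ArithmeticFunction ℝ :=
    ⟨fun n => supportedInd P n * ArithmeticFunction.vonMangoldt n, by simp⟩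
  have hF : ∀ n, F n = supportedInd P n := fun _ => rfl
  have hG : ∀ n, G n = supportedInd P n * ArithmeticFunction.vonMangoldt n := fun _ => rfl
  have h := ArithmeticFunction.sum_Ioc_mul_eq_sum_sum F G ⌊x⌋₊
  have h1 : ∀ n, (F * G) n = supportedInd P n * Real.log n := by
    intro n
    rw [ArithmeticFunction.mul_apply, ← ArithmeticFunction.vonMangoldt_sum,
      ← Nat.sum_divisorsAntidiagonal' fun _ i => ArithmeticFunction.vonMangoldt i, Finset.mul_sum]
    refine Finset.sum_congr rfl fun d hd => ?_
    rw [← (Nat.mem_divisorsAntidiagonal.1 hd).1, map_mul, hF, hG]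
    ring
  simp only [h1] at h
  rw [h]
  refine Finset.sum_congr rfl fun n _ => ?_
  rw [supportedPsi, Nat.floor_div_natCast]
  rfl

theorem sum_supportedInd_mul_log_div_le {x : ℝ} (hx : 0 < x) :
    ∑ n ∈ Finset.Ioc 0 ⌊x⌋₊, supportedInd P n * (Real.log x - Real.log n) ≤ x := by
  have h1 : ∑ n ∈ Finset.Ioc 0 ⌊x⌋₊, supportedInd P n * (Real.log x - Real.log n) ≤
      ∑ n ∈ Finset.Ioc 0 ⌊x⌋₊, (Real.log x - Real.log n) := by
    refine Finset.sum_le_sum fun n hn => ?_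
    obtain ⟨hn0, hn1⟩ := Finset.mem_Ioc.1 hn
    refine mul_le_of_le_one_left (sub_nonneg.2 ?_) (supportedInd_le_one n)
    exact Real.log_le_log (by exact_mod_cast hn0) ((Nat.le_floor_iff hx.le).1 hn1)
  have h2 : ∀ N : ℕ, ∑ n ∈ Finset.Ioc 0 N, Real.log n = Real.log (N.factorial) := by
    intro N
    induction N with
    | zero => simp
    | succ N ih =>
      rw [Finset.sum_Ioc_succ_top N.zero_le, ih, Nat.factorial_succ, Nat.cast_mul,
        Real.log_mul (by positivity) (by positivity), add_comm]
  refine h1.trans ?_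
  rw [Finset.sum_sub_distrib, h2, Finset.sum_const, Nat.card_Ioc, Nat.sub_zero, nsmul_eq_mul,
    ← Real.log_pow, ← Real.log_div (by positivity) (by positivity)]
  exact (Real.log_le_iff_le_exp (by positivity)).2 (Real.pow_div_factorial_le_exp x hx.le _)

theorem cntF_primeSupported (x : ℝ) :
    (cntF (primeSupported P) x : ℝ) = ∑ n ∈ Finset.Ioc 0 ⌊x⌋₊, supportedInd P n := by
  classical
  have h1 : primeSupported P ∩ Set.Icc 1 ⌊x⌋₊ =
      ((Finset.Ioc 0 ⌊x⌋₊).filter (· ∈ primeSupported P) : Finset ℕ) := by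
    ext n
    simp only [Set.mem_inter_iff, Set.mem_Icc, Finset.coe_filter, Finset.mem_Ioc, Set.mem_ofPred_eq,
      Nat.succ_le_iff, and_comm]
  rw [cntF, h1, Set.ncard_coe_finset, Finset.card_filter, Nat.cast_sum]
  refine Finset.sum_congr rfl fun n _ => ?_
  split_ifs with hn
  · rw [supportedInd_of_mem hn, Nat.cast_one]
  · rw [supportedInd_of_notMem hn, Nat.cast_zero]

/-- Wirsing-type asymptotics for the counting function of `primeSupported P`. -/
theorem tendsto_cntF_primeSupported [DecidablePred P] {τ a : ℝ} (hτ : τ ∈ Set.Ioo (0 : ℝ) 1)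
    (ha : 0 < a)
    (h : Tendsto (fun N : ℕ => ∑ m ∈ Finset.range N,
      if m.Prime then ((if P m then 1 else 0) - τ) * eulerWeight m else 0) atTop (𝓝 (log a)))
    (hθ : Tendsto (fun x : ℝ => (∑ m ∈ Finset.range (⌊x⌋₊ + 1),
      if m.Prime then (if P m then Real.log m else 0) else 0) / x) atTop (𝓝 τ)) :
    Tendsto (fun x : ℝ => (cntF (primeSupported P) x : ℝ) * Real.log x ^ (1 - τ) / x) atTop
      (𝓝 (a / Gamma τ)) := by
  have hτ0 := hτ.1
  have hterm : ∀ δ : ℝ, 0 < δ → ∀ n : ℕ, supportedInd P n / n * (n : ℝ) ^ (-δ) =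
      supportedInd P n * (n : ℝ) ^ (-(1 + δ)) := by
    intro δ hδ n
    rcases Nat.eq_zero_or_pos n with rfl | hn
    · simp
    · rw [neg_add, rpow_add (by exact_mod_cast hn), rpow_neg_one]
      ring
  set S : ℝ → ℝ := fun x => ∑ n ∈ Finset.Ioc 0 ⌊x⌋₊, supportedInd P n / n with hS
  have hL : Tendsto (fun x : ℝ => S x / log x ^ τ) atTop (𝓝 (a / Gamma τ * (1 / τ))) := by
    refine tendsto_sum_div_log_rpow (μ := fun n => supportedInd P n / n) hτ0
      (fun n => div_nonneg (supportedInd_nonneg n) n.cast_nonneg) (fun δ hδ => ?_) ha.le ?_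
    · exact (summable_supportedInd_mul_rpow (by linarith : 1 < 1 + δ)).congr
        fun n => (hterm δ hδ n).symm
    · refine (tendsto_rpow_mul_tsum_supportedInd hτ ha h).congr' ?_
      filter_upwards [self_mem_nhdsWithin] with δ hδ
      rw [tsum_congr (hterm δ hδ)]
  set T : ℝ → ℝ := fun x => ∑ n ∈ Finset.Ioc 0 ⌊x⌋₊, supportedInd P n * Real.log n with hT
  have hψ := tendsto_supportedPsi_div hθ
  have hlogτ : Tendsto (fun x : ℝ => log x ^ τ) atTop atTop :=
    (tendsto_rpow_atTop hτ0).comp tendsto_log_atTop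
  have hTS : ∀ ε > 0, ∃ C, 0 ≤ C ∧ ∀ x, 0 < x → |T x - τ * x * S x| ≤ ε * x * S x + C * x := by
    intro ε hε
    obtain ⟨C, hC⟩ := exists_abs_supportedPsi_sub_le hτ0.le hψ hε
    have hC0 : 0 ≤ C := by simpa using (abs_nonneg _).trans (hC 0 le_rfl)
    refine ⟨C, hC0, fun x hx => ?_⟩
    have h1 : T x - τ * x * S x = ∑ n ∈ Finset.Ioc 0 ⌊x⌋₊,
        supportedInd P n * (supportedPsi P (x / n) - τ * (x / n)) := by
      rw [hT, hS]
      simp only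
      rw [sum_supportedInd_mul_log, Finset.mul_sum, ← Finset.sum_sub_distrib]
      exact Finset.sum_congr rfl fun n _ => by ring
    rw [h1]
    calc |∑ n ∈ Finset.Ioc 0 ⌊x⌋₊, supportedInd P n * (supportedPsi P (x / n) - τ * (x / n))|
        ≤ ∑ n ∈ Finset.Ioc 0 ⌊x⌋₊, (ε * x * (supportedInd P n / n) + C) := by
          refine (Finset.abs_sum_le_sum_abs _ _).trans (Finset.sum_le_sum fun n _ => ?_)
          rw [abs_mul, abs_of_nonneg (supportedInd_nonneg n)]
          refine (mul_le_mul_of_nonneg_left (hC (x / n) (by positivity))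
            (supportedInd_nonneg n)).trans ?_
          have := mul_le_of_le_one_left hC0 (supportedInd_le_one (P := P) n)
          rw [mul_add]
          refine add_le_add (le_of_eq ?_) this
          ring
      _ = ε * x * S x + ⌊x⌋₊ * C := by
          rw [Finset.sum_add_distrib, ← Finset.mul_sum, Finset.sum_const, Nat.card_Ioc,
            Nat.sub_zero, nsmul_eq_mul]
      _ ≤ ε * x * S x + C * x := by
          have := mul_le_mul_of_nonneg_right (Nat.floor_le hx.le) hC0
          linarith
  have hdiff : Tendsto (fun x : ℝ => T x / (x * log x ^ τ) - τ * (S x / log x ^ τ)) atTop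
      (𝓝 0) := by
    rw [Metric.tendsto_nhds]
    intro ε hε
    set l := a / Gamma τ * (1 / τ) with hl
    have hl0 : 0 ≤ l := mul_nonneg (div_nonneg ha.le (Gamma_pos_of_pos hτ0).le) (by positivity)
    obtain ⟨C, hC0, hC⟩ := hTS (ε / (l + 1)) (by positivity)
    have hlim : Tendsto (fun x : ℝ => ε / (l + 1) * (S x / log x ^ τ) + C / log x ^ τ) atTop
        (𝓝 (ε / (l + 1) * l + 0)) :=
      (hL.const_mul _).add (tendsto_const_nhds.div_atTop hlogτ)
    have hlt : ε / (l + 1) * l + 0 < ε := by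
      rw [add_zero, div_mul_eq_mul_div, div_lt_iff₀ (by positivity)]
      linarith
    filter_upwards [hlim.eventually_lt_const hlt, eventually_gt_atTop 1] with x hx hx1
    have hx0 : 0 < x := by linarith
    have hlog : 0 < log x ^ τ := rpow_pos_of_pos (log_pos hx1) _
    refine lt_of_le_of_lt ?_ hx
    rw [Real.dist_eq, sub_zero,
      show T x / (x * log x ^ τ) - τ * (S x / log x ^ τ) = (T x - τ * x * S x) / (x * log x ^ τ) by
        field_simp,
      abs_div, abs_of_pos (mul_pos hx0 hlog), div_le_iff₀ (mul_pos hx0 hlog)]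
    refine (hC x hx0).trans (le_of_eq ?_)
    field_simp
  have hTlim : Tendsto (fun x : ℝ => T x / (x * log x ^ τ)) atTop (𝓝 (a / Gamma τ)) := by
    have := hdiff.add (hL.const_mul τ)
    rw [zero_add, show τ * (a / Gamma τ * (1 / τ)) = a / Gamma τ by
      have := hτ0.ne'
      field_simp] at this
    exact this.congr fun x => sub_add_cancel _ _
  have hrem : Tendsto (fun x : ℝ => (∑ n ∈ Finset.Ioc 0 ⌊x⌋₊,
      supportedInd P n * (Real.log x - Real.log n)) / (x * log x ^ τ)) atTop (𝓝 0) := by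
    refine squeeze_zero' ?_ ?_ hlogτ.inv_tendsto_atTop
    · filter_upwards [eventually_gt_atTop 1] with x hx
      have hx0 : 0 < x := by linarith
      refine div_nonneg (Finset.sum_nonneg fun n hn => ?_)
        (mul_nonneg hx0.le (rpow_nonneg (log_pos hx).le _))
      obtain ⟨hn0, hn1⟩ := Finset.mem_Ioc.1 hn
      refine mul_nonneg (supportedInd_nonneg n) (sub_nonneg.2 ?_)
      exact Real.log_le_log (by exact_mod_cast hn0) ((Nat.le_floor_iff hx0.le).1 hn1)
    · filter_upwards [eventually_gt_atTop 1] with x hx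
      have hx0 : 0 < x := by linarith
      have hlog : 0 < log x ^ τ := rpow_pos_of_pos (log_pos hx) _
      rw [Pi.inv_apply, div_le_iff₀ (mul_pos hx0 hlog)]
      refine (sum_supportedInd_mul_log_div_le hx0).trans (le_of_eq ?_)
      field_simp
  have hfin := hTlim.add hrem
  rw [add_zero] at hfin
  refine hfin.congr' ?_
  filter_upwards [eventually_gt_atTop 1] with x hx
  have hx0 : 0 < x := by linarith
  have hlog := log_pos hx
  have hne := (rpow_pos_of_pos hlog τ).ne'
  rw [← add_div, cntF_primeSupported, rpow_sub hlog, rpow_one]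
  simp only [hT]
  rw [← Finset.sum_add_distrib]
  have : ∑ n ∈ Finset.Ioc 0 ⌊x⌋₊, (supportedInd P n * Real.log n +
      supportedInd P n * (Real.log x - Real.log n)) =
      (∑ n ∈ Finset.Ioc 0 ⌊x⌋₊, supportedInd P n) * Real.log x := by
    rw [Finset.sum_mul]
    exact Finset.sum_congr rfl fun n _ => by ring
  rw [this]
  field_simp

end SupportedCount

section Factorization

theorem exists_prod_eq_of_primeSupported {h : ℕ} (col : ℕ → Fin h) (n : ℕ) :
    n ≠ 0 → ∃ f : Fin h → ℕ, (∀ i, f i ∈ primeSupported fun p => col p = i) ∧ ∏ i, f i = n := by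
  induction n using induction_on_primes with
  | zero => exact fun h0 => absurd rfl h0
  | one => exact fun _ => ⟨fun _ => 1, fun i => one_mem_primeSupported, by simp⟩
  | prime_mul p n hp ih =>
    intro hpn
    obtain ⟨f, hf, hfn⟩ := ih (right_ne_zero_of_mul hpn)
    refine ⟨fun i => (if col p = i then p else 1) * f i, fun i => ?_, ?_⟩
    · rw [mul_mem_primeSupported_iff]
      refine ⟨?_, hf i⟩
      split_ifs with hi
      · exact (prime_mem_primeSupported_iff hp).2 hi
      · exact one_mem_primeSupported
    · rw [Finset.prod_mul_distrib, hfn, Finset.prod_ite_eq, if_pos (Finset.mem_univ _)]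

theorem isMC_primeSupported {h : ℕ} (col : ℕ → Fin h) :
    IsMC h fun i => primeSupported fun p => col p = i := by
  intro n hn
  have hfin : {f : Fin h → ℕ | (∀ i, f i ∈ primeSupported fun p => col p = i) ∧
      ∏ i, f i = n}.Finite := by
    refine (Set.Finite.pi' fun _ : Fin h => Set.finite_Iic n).subset ?_
    rintro f ⟨-, hf⟩ i
    exact Nat.le_of_dvd hn (hf ▸ Finset.dvd_prod_of_mem f (Finset.mem_univ i))
  exact (Set.ncard_pos hfin).2 (exists_prod_eq_of_primeSupported col n (by omega))

end Factorization

theorem stmt4 (h : ℕ) (hh : 1 ≤ h)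
    (τ : Fin h → ℝ) (hτ : ∀ i, τ i ∈ Set.Ioo (0 : ℝ) 1) (hsum : ∑ i, τ i = 1)
    (a : Fin h → ℝ) (ha : ∀ i, 0 < a i) (hprod : ∏ i, a i = 1) :
    ∃ A : Fin h → Set ℕ, (∀ i, 0 ∉ A i) ∧ IsMC h A ∧
      ∀ i, Filter.Tendsto (fun x : ℝ =>
          (cntF (A i) x : ℝ) * Real.log x ^ (1 - τ i) / x)
        Filter.atTop (nhds (a i / Real.Gamma (τ i))) := by
  have : Nonempty (Fin h) := ⟨⟨0, hh⟩⟩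
  have hα : ∑ i, Real.log (a i) = 0 := by
    rw [← Real.log_prod fun i _ => (ha i).ne', hprod, Real.log_one]
  obtain ⟨col, hcol⟩ := exists_prime_coloring τ (fun i => Real.log (a i)) (fun i => (hτ i).1)
    (fun i => (hτ i).2) hsum hα
  exact ⟨fun i => primeSupported fun p => col p = i, fun i => zero_notMem_primeSupported,
    isMC_primeSupported col,
    fun i => tendsto_cntF_primeSupported (hτ i) (ha i) (hcol i).1 (hcol i).2⟩
end

section
/- Let h ∈ ℤ⁺. For every multiplicative complement (A_1,…,A_h) of order h, one has limsup_{x→∞} max{A_1(x),…,A_h(x)} · (log x)^{1-1/h} / x ≥ 1/Γ(1/h). -/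
open Filter Real

open MeasureTheory Topology

open Classical in
/-- The partial sums of `∑ n⁻ˢ` are bounded by products of partial sums over a complement. -/
lemma IsMC.sum_rpow_le_prod {h : ℕ} {A : Fin h → Set ℕ} (hMC : IsMC h A) (s : ℝ) (N : ℕ) :
    ∑ n ∈ Finset.Icc 1 N, (n : ℝ) ^ (-s) ≤
      ∏ i, ∑ a ∈ (Finset.Icc 1 N).filter (· ∈ A i), (a : ℝ) ^ (-s) := by
  have hex : ∀ n : ℕ, ∃ f : Fin h → ℕ, 1 ≤ n → (∀ i, f i ∈ A i) ∧ ∏ i, f i = n := by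
    intro n
    by_cases hn : 1 ≤ n
    · have hpos := hMC n hn
      obtain ⟨f, hf⟩ := Set.nonempty_of_ncard_ne_zero (Nat.one_le_iff_ne_zero.mp hpos)
      exact ⟨f, fun _ => hf⟩
    · exact ⟨0, fun h' => absurd h' hn⟩
  choose f hf using hex
  rw [Finset.prod_univ_sum]
  have hinj : Set.InjOn f (Finset.Icc 1 N : Finset ℕ) := by
    intro m hm n hn hmn
    rw [← (hf m (Finset.mem_Icc.mp hm).1).2, hmn, (hf n (Finset.mem_Icc.mp hn).1).2]
  calc ∑ n ∈ Finset.Icc 1 N, (n : ℝ) ^ (-s)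
      = ∑ n ∈ Finset.Icc 1 N, ∏ i, (f n i : ℝ) ^ (-s) := by
        refine Finset.sum_congr rfl fun n hn => ?_
        rw [Real.finsetProd_rpow _ _ fun i _ => Nat.cast_nonneg _, ← Nat.cast_prod,
          (hf n (Finset.mem_Icc.mp hn).1).2]
    _ = ∑ g ∈ (Finset.Icc 1 N).image f, ∏ i, (g i : ℝ) ^ (-s) := by
        rw [Finset.sum_image hinj]
    _ ≤ _ := by
        refine Finset.sum_le_sum_of_subset_of_nonneg ?_ fun g _ _ =>
          Finset.prod_nonneg fun i _ => Real.rpow_nonneg (Nat.cast_nonneg _) _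
        intro g hg
        obtain ⟨n, hn, rfl⟩ := Finset.mem_image.mp hg
        obtain ⟨hn1, hnN⟩ := Finset.mem_Icc.mp hn
        obtain ⟨hmem, hprod⟩ := hf n hn1
        refine Fintype.mem_piFinset.mpr fun i => ?_
        have hdvd : f n i ∣ n := by
          conv_rhs => rw [← hprod]
          exact Finset.dvd_prod_of_mem _ (Finset.mem_univ i)
        have h1 : 1 ≤ f n i := Nat.pos_of_dvd_of_pos hdvd hn1
        have h2 : f n i ≤ N := (Nat.le_of_dvd hn1 hdvd).trans hnN
        simp [hmem i, h1, h2]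

/-- A bound on the counting function of `S` bounds its Dirichlet sum via the Laplace transform. -/
lemma sum_rpow_le_of_card_le {S : Finset ℕ} (hS : ∀ a ∈ S, 1 ≤ a) {s α B c : ℝ} (hs : 1 < s)
    (hα : 0 < α)
    (hcard : ∀ u : ℝ, 0 < u →
      ((S.filter fun a : ℕ => Real.log a < u).card : ℝ) ≤
        B + c * (Real.exp u * u ^ (α - 1))) :
    ∑ a ∈ S, (a : ℝ) ^ (-s) ≤ B + c * s * Real.Gamma α * (s - 1) ^ (-α) := by
  have hs0 : 0 < s := by linarith
  have hs1 : 0 < s - 1 := by linarith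
  have hI : IntegrableOn (fun u : ℝ => Real.exp (-s * u)) (Set.Ioi 0) :=
    integrableOn_exp_mul_Ioi (by linarith) 0
  have hG : ∫ u in Set.Ioi (0 : ℝ), u ^ (α - 1) * Real.exp (-((s - 1) * u)) =
      (1 / (s - 1)) ^ α * Real.Gamma α := Real.integral_rpow_mul_exp_neg_mul_Ioi hα hs1
  have hGI : IntegrableOn (fun u : ℝ => u ^ (α - 1) * Real.exp (-((s - 1) * u)))
      (Set.Ioi 0) := by
    refine not_imp_comm.mp integral_undef ?_
    rw [hG]
    have := Real.Gamma_pos_of_pos hα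
    positivity
  have hterm : ∀ a ∈ S, (a : ℝ) ^ (-s) =
      ∫ u in Set.Ioi (0 : ℝ),
        (Set.Ioi (Real.log a)).indicator (fun u => s * Real.exp (-s * u)) u := by
    intro a ha
    have ha1 : (1 : ℝ) ≤ a := by exact_mod_cast hS a ha
    rw [setIntegral_indicator measurableSet_Ioi, Set.Ioi_inter_Ioi,
      max_eq_right (Real.log_nonneg ha1), integral_const_mul, integral_exp_mul_Ioi (by linarith),
      Real.rpow_def_of_pos (by linarith), mul_comm (Real.log a)]
    field_simp
  have htermI : ∀ a ∈ S, IntegrableOn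
      ((Set.Ioi (Real.log a)).indicator (fun u => s * Real.exp (-s * u))) (Set.Ioi 0) :=
    fun a _ => (hI.const_mul s).indicator measurableSet_Ioi
  have hB : IntegrableOn (fun u : ℝ => B * s * Real.exp (-s * u)) (Set.Ioi 0) :=
    hI.const_mul (B * s)
  have hC : IntegrableOn
      (fun u : ℝ => c * s * (u ^ (α - 1) * Real.exp (-((s - 1) * u)))) (Set.Ioi 0) :=
    hGI.const_mul (c * s)
  calc ∑ a ∈ S, (a : ℝ) ^ (-s)
      = ∫ u in Set.Ioi (0 : ℝ), ∑ a ∈ S,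
          (Set.Ioi (Real.log a)).indicator (fun u => s * Real.exp (-s * u)) u := by
        rw [integral_finsetSum _ htermI]
        exact Finset.sum_congr rfl hterm
    _ ≤ ∫ u in Set.Ioi (0 : ℝ), (B * s * Real.exp (-s * u) +
          c * s * (u ^ (α - 1) * Real.exp (-((s - 1) * u)))) := by
        refine setIntegral_mono_on (integrable_finsetSum _ htermI) (hB.add hC)
          measurableSet_Ioi fun u hu => ?_
        have hsum : ∑ a ∈ S,
            (Set.Ioi (Real.log a)).indicator (fun u => s * Real.exp (-s * u)) u =
            (S.filter fun a : ℕ => Real.log a < u).card * (s * Real.exp (-s * u)) := by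
          simp only [Set.indicator_apply, Set.mem_Ioi]
          rw [← Finset.sum_filter, Finset.sum_const, nsmul_eq_mul]
        have hexp : Real.exp (-((s - 1) * u)) = Real.exp u * Real.exp (-s * u) := by
          rw [← Real.exp_add]; ring_nf
        rw [hsum, hexp]
        calc _ ≤ (B + c * (Real.exp u * u ^ (α - 1))) * (s * Real.exp (-s * u)) :=
              mul_le_mul_of_nonneg_right (hcard u hu) (by positivity)
          _ = _ := by ring
    _ = B + c * s * Real.Gamma α * (s - 1) ^ (-α) := by
        rw [integral_add hB hC, integral_const_mul, integral_const_mul, hG,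
          integral_exp_mul_Ioi (by linarith), one_div, Real.inv_rpow hs1.le, Real.rpow_neg hs1.le]
        simp only [mul_zero, Real.exp_zero]
        field_simp

lemma cntF_le (A : Set ℕ) (x : ℝ) : cntF A x ≤ ⌊x⌋₊ := by
  calc cntF A x ≤ (Set.Icc 1 ⌊x⌋₊).ncard :=
        Set.ncard_le_ncard Set.inter_subset_right (Set.finite_Icc _ _)
    _ = ⌊x⌋₊ := by simp [Set.ncard_eq_toFinset_card']

/-- An eventual upper bound for the normalized counting functions of a complement gives a lower
bound for the constant. -/
lemma IsMC.one_le_mul_Gamma {h : ℕ} (hh : 1 ≤ h) {A : Fin h → Set ℕ} (hMC : IsMC h A) {c : ℝ}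
    (hev : ∀ᶠ x : ℝ in atTop, ∀ i,
      (cntF (A i) x : ℝ) * Real.log x ^ (1 - 1 / (h : ℝ)) / x ≤ c) :
    1 ≤ c * Real.Gamma (1 / h) := by
  classical
  have hh0 : (0 : ℝ) < h := by exact_mod_cast hh
  set α : ℝ := 1 / h with hαdef
  have hα : 0 < α := by positivity
  have hΓ := Real.Gamma_pos_of_pos hα
  obtain ⟨X, hX⟩ := eventually_atTop.mp (hev.and (eventually_ge_atTop 1))
  have hc : 0 ≤ c := by
    refine le_trans ?_ ((hX X le_rfl).1 ⟨0, hh⟩)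
    have hX1 := (hX X le_rfl).2
    have := Real.log_nonneg hX1
    positivity
  have hX1 : 1 ≤ X := (hX X le_rfl).2
  have hcnt : ∀ i, ∀ u : ℝ, 0 < u →
      (cntF (A i) (Real.exp u) : ℝ) ≤ X + c * (Real.exp u * u ^ (α - 1)) := by
    intro i u hu
    have hu' : 0 ≤ u ^ (α - 1) := by positivity
    have he := Real.exp_pos u
    rcases le_total X (Real.exp u) with hle | hle
    · have hb := (hX _ hle).1 i
      rw [Real.log_exp, div_le_iff₀ he] at hb
      have hone : u ^ (1 - α) * u ^ (α - 1) = 1 := by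
        rw [← Real.rpow_add hu]; simp
      have := mul_le_mul_of_nonneg_right hb hu'
      rw [mul_assoc, hone, mul_one] at this
      linarith
    · have h1 : (cntF (A i) (Real.exp u) : ℝ) ≤ Real.exp u :=
        (Nat.cast_le.mpr (cntF_le _ _)).trans (Nat.floor_le he.le)
      have : 0 ≤ c * (Real.exp u * u ^ (α - 1)) := by positivity
      linarith
  have hbound : ∀ s : ℝ, 1 < s →
      ∑' n : ℕ, 1 / (n : ℝ) ^ s ≤ (X + c * s * Real.Gamma α * (s - 1) ^ (-α)) ^ h := by
    intro s hs
    have hsum : Summable fun n : ℕ => 1 / (n : ℝ) ^ s := Real.summable_one_div_nat_rpow.mpr hs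
    refine le_of_tendsto' (hsum.hasSum.tendsto_sum_nat.comp (tendsto_add_atTop_nat 1))
      fun N => ?_
    have hconv : ∑ n ∈ Finset.range (N + 1), 1 / (n : ℝ) ^ s =
        ∑ n ∈ Finset.Icc 1 N, (n : ℝ) ^ (-s) := by
      rw [Finset.range_eq_Ico, Finset.sum_eq_sum_Ico_succ_bot (Nat.succ_pos N)]
      have h0 : (0 : ℝ) ^ s = 0 := Real.zero_rpow (by linarith)
      simp only [Nat.cast_zero, h0, div_zero, zero_add]
      refine Finset.sum_congr rfl fun n _ => ?_
      rw [Real.rpow_neg (Nat.cast_nonneg n), one_div]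
    simp only [Function.comp_apply]
    rw [hconv]
    refine (hMC.sum_rpow_le_prod s N).trans ?_
    refine (Finset.prod_le_prod (fun i _ => Finset.sum_nonneg fun a _ =>
      Real.rpow_nonneg (Nat.cast_nonneg a) _) fun i _ => sum_rpow_le_of_card_le ?_ hs hα
        fun u hu => ?_).trans_eq (by rw [Finset.prod_const, Finset.card_univ, Fintype.card_fin])
    · exact fun a ha => (Finset.mem_Icc.mp (Finset.mem_filter.mp ha).1).1
    · refine le_trans (Nat.cast_le.mpr ?_) (hcnt i u hu)
      rw [← Set.ncard_coe_finset]
      refine Set.ncard_le_ncard (fun a ha => ?_) ((Set.finite_Icc _ _).inter_of_right _)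
      simp only [Finset.coe_filter, Finset.mem_filter, Finset.mem_Icc, Set.mem_ofPred_eq] at ha
      obtain ⟨⟨⟨ha1, -⟩, haA⟩, hau⟩ := ha
      have hapos : (0 : ℝ) < a := by exact_mod_cast ha1
      exact ⟨haA, ha1, Nat.le_floor ((Real.log_lt_iff_lt_exp hapos).mp hau).le⟩
  have hlim : Tendsto (fun s : ℝ => ((s - 1) ^ α * X + c * s * Real.Gamma α) ^ h) (𝓝[>] 1)
      (𝓝 ((c * Real.Gamma α) ^ h)) := by
    have hcont : ContinuousAt
        (fun s : ℝ => ((s - 1) ^ α * X + c * s * Real.Gamma α) ^ h) 1 := by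
      have : ContinuousAt (fun s : ℝ => (s - 1) ^ α) 1 :=
        (by fun_prop : ContinuousAt (fun s : ℝ => s - 1) 1).rpow_const (Or.inr hα.le)
      fun_prop
    have := hcont.tendsto.mono_left (nhdsWithin_le_nhds (s := Set.Ioi 1))
    simpa [Real.zero_rpow hα.ne'] using this
  have hle : 1 ≤ (c * Real.Gamma α) ^ h := by
    refine le_of_tendsto_of_tendsto tendsto_sub_mul_tsum_nat_rpow hlim ?_
    filter_upwards [self_mem_nhdsWithin] with s hs
    have hs1 : 0 < s - 1 := sub_pos.mpr hs
    have hpow : ((s - 1) ^ α) ^ h = s - 1 := by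
      rw [← Real.rpow_natCast, ← Real.rpow_mul hs1.le, hαdef, one_div_mul_cancel hh0.ne',
        Real.rpow_one]
    calc (s - 1) * ∑' n : ℕ, 1 / (n : ℝ) ^ s
        ≤ (s - 1) * (X + c * s * Real.Gamma α * (s - 1) ^ (-α)) ^ h :=
          mul_le_mul_of_nonneg_left (hbound s hs) hs1.le
      _ = ((s - 1) ^ α * (X + c * s * Real.Gamma α * (s - 1) ^ (-α))) ^ h := by
          rw [mul_pow, hpow]
      _ = _ := by
          rw [Real.rpow_neg hs1.le]
          have := (Real.rpow_pos_of_pos hs1 α).ne'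
          field_simp
  by_contra! hlt
  exact absurd hle (not_le.mpr (pow_lt_one₀ (by positivity) hlt (by omega)))

theorem stmt5 (h : ℕ) (hh : 1 ≤ h) (A : Fin h → Set ℕ) (hA0 : ∀ i, 0 ∉ A i)
    (hMC : IsMC h A) :
    (((Real.Gamma (1 / h))⁻¹ : ℝ) : EReal) ≤
      Filter.limsup (fun x : ℝ =>
        ((((Finset.univ.sup fun i => cntF (A i) x : ℕ) : ℝ) *
          Real.log x ^ (1 - 1 / (h : ℝ)) / x : ℝ) : EReal)) Filter.atTop := by
  by_contra! hlt
  have hΓ : 0 < Real.Gamma (1 / h) :=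
    Real.Gamma_pos_of_pos (one_div_pos.mpr (by exact_mod_cast hh))
  obtain ⟨c, hc1, hc2⟩ := EReal.lt_iff_exists_real_btwn.mp hlt
  have hev := eventually_lt_of_limsup_lt hc1
  have hge : 1 ≤ c * Real.Gamma (1 / h) := by
    refine hMC.one_le_mul_Gamma hh ?_
    filter_upwards [hev, eventually_ge_atTop 1] with x hx hx1 i
    have hle : (cntF (A i) x : ℝ) ≤ (Finset.univ.sup fun i => cntF (A i) x : ℕ) :=
      Nat.cast_le.mpr (Finset.le_sup (f := fun i => cntF (A i) x) (Finset.mem_univ i))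
    have hlog := Real.log_nonneg hx1
    refine le_trans ?_ (EReal.coe_lt_coe_iff.mp hx).le
    gcongr
  have hlt' : c < (Real.Gamma (1 / h))⁻¹ := EReal.coe_lt_coe_iff.mp hc2
  rw [← one_div, lt_div_iff₀ hΓ] at hlt'
  exact absurd hge (not_le.mpr hlt')
end
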